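/- Let (G_k) be a sequence of finite simple graphs such that: (i) for every r ∈ ℕ, the proportion of (4,r)-tree-like vertices of G_k tends to 1 as k → ∞; and (ii) the average degree 2·|E(G_k)|/|V(G_k)| tends to 4 as k → ∞. Then limsup_{k→∞} ( min{ size(S)/|V(G_k)| : S a bisection of G_k } ) < 1/3 and liminf_{k→∞} ( max{ size(S)/|V(G_k)| : S a bisection of G_k } ) > 5/3. -/

import Mathlib

open Filter Real

/-- `x` is a `(d,r)`-tree-like vertex of `H`: the subgraph induced on the ball of radius
`r` about `x` is acyclic, and every vertex at distance at most `r-1` from `x` has degree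
exactly `d` in `H`. -/
def TreeLikeVtx {W : Type*} (H : SimpleGraph W) (d r : ℕ) (x : W) : Prop :=
  (H.induce {y : W | H.Reachable x y ∧ H.dist x y ≤ r}).IsAcyclic ∧
    ∀ y : W, H.Reachable x y → H.dist x y + 1 ≤ r → (H.neighborSet y).ncard = d

/-- `S` is a bisection: its size and the size of its complement differ by at most 1. -/
def IsBisection {W : Type*} (S : Set W) : Prop :=
  S.ncard ≤ Sᶜ.ncard + 1 ∧ Sᶜ.ncard ≤ S.ncard + 1

/-- The size of the bisection `S`: the number of edges with exactly one endpoint in `S`. -/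
noncomputable def bisectionSize {W : Type*} (H : SimpleGraph W) (S : Set W) : ℕ :=
  {e ∈ H.edgeSet | ∃ u v : W, e = s(u, v) ∧ u ∈ S ∧ v ∉ S}.ncard

namespace SimpleGraph

variable {W : Type*} {H : SimpleGraph W} {d r : ℕ} {v w x y u : W}

theorem _root_.TreeLikeVtx.path_unique (hv : TreeLikeVtx H d r v) {p q : H.Walk v u}
    (hp : p.IsPath) (hq : q.IsPath) (hpr : p.length ≤ r) (hqr : q.length ≤ r) : p = q := by
  classical
  have key : ∀ s : H.Walk v u, s.length ≤ r →
      ∀ z ∈ s.support, z ∈ {y : W | H.Reachable v y ∧ H.dist v y ≤ r} := by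
    intro s hs z hz
    exact ⟨(s.takeUntil z hz).reachable,
      (dist_le _).trans ((s.length_takeUntil_le_length hz).trans hs)⟩
  have hu := (hv.1.subsingleton_path _ _).elim ⟨p.induce _ (key p hpr), ?_⟩
    ⟨q.induce _ (key q hqr), ?_⟩
  · have := congrArg (fun a => (a.1.map (Embedding.induce (G := H) _).toHom)) hu
    simpa [Walk.map_induce] using this
  · rw [← Walk.isPath_map_iff_of_injective (f := (Embedding.induce (G := H) _).toHom)
      (Embedding.induce (G := H) _).injective, Walk.map_induce]
    exact hp
  · rw [← Walk.isPath_map_iff_of_injective (f := (Embedding.induce (G := H) _).toHom)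
      (Embedding.induce (G := H) _).injective, Walk.map_induce]
    exact hq

/-- A geodesic from `w` avoids a vertex at least as far from its end as `w`. -/
theorem notMem_support_of_dist_le {p : H.Walk w u} (hp : p.length = H.dist w u) (hne : w ≠ v)
    (h : H.dist w u ≤ H.dist v u) : v ∉ p.support := by
  classical
  intro hmem
  have h1 := dist_le (p.dropUntil v hmem)
  have h2 : (p.takeUntil v hmem).length + (p.dropUntil v hmem).length = p.length := by
    rw [← Walk.length_append, Walk.take_spec]
  have h3 : 0 < (p.takeUntil v hmem).length := by
    rw [Nat.pos_iff_ne_zero]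
    exact fun h0 => hne (Walk.eq_of_length_eq_zero h0)
  omega

theorem _root_.TreeLikeVtx.dist_ne_of_adj (hv : TreeLikeVtx H d r v) (hvw : H.Adj v w)
    (hu : H.Reachable v u) (hr : H.dist v u + 1 ≤ r) : H.dist w u ≠ H.dist v u := by
  intro h
  obtain ⟨p, hp⟩ := (hvw.symm.reachable.trans hu).exists_walk_length_eq_dist
  obtain ⟨q, hq⟩ := hu.exists_walk_length_eq_dist
  have h1 : (Walk.cons hvw p).IsPath :=
    (p.isPath_of_length_eq_dist hp).cons (notMem_support_of_dist_le hp hvw.ne' h.le)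
  have h2 := hv.path_unique h1 (q.isPath_of_length_eq_dist hq)
    (by simp; omega) (by omega)
  have h3 := congrArg Walk.length h2
  simp at h3
  omega

theorem _root_.TreeLikeVtx.first_step_unique (hv : TreeLikeVtx H d r v) (hvw : H.Adj v w)
    (hvx : H.Adj v x) (hu : H.Reachable v u) (hr : H.dist v u ≤ r)
    (hw : H.dist w u + 1 = H.dist v u) (hx : H.dist x u + 1 = H.dist v u) : w = x := by
  obtain ⟨p, hp⟩ := (hvw.symm.reachable.trans hu).exists_walk_length_eq_dist
  obtain ⟨q, hq⟩ := (hvx.symm.reachable.trans hu).exists_walk_length_eq_dist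
  have h2 := hv.path_unique
    ((Walk.cons hvw p).isPath_of_length_eq_dist (by simp; omega))
    ((Walk.cons hvx q).isPath_of_length_eq_dist (by simp; omega))
    (by simp; omega) (by simp; omega)
  simpa using congrArg Walk.snd h2

theorem _root_.TreeLikeVtx.dist_ne_of_adj' (hv : TreeLikeVtx H d r v) (hxy : H.Adj x y)
    (hx : H.Reachable v x) (hr : H.dist v x + 1 ≤ r) : H.dist v y ≠ H.dist v x := by
  intro h
  obtain ⟨p, hp⟩ := hx.exists_walk_length_eq_dist
  obtain ⟨q, hq⟩ := (hx.trans hxy.reachable).exists_walk_length_eq_dist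
  have h0 : y ∉ p.support := by
    have := notMem_support_of_dist_le (p := p.reverse) (v := y)
      (by rw [Walk.length_reverse, hp, dist_comm]) hxy.ne
      (by rw [dist_comm, ← h, dist_comm])
    simpa using this
  have h1 : (p.concat hxy).IsPath := (p.isPath_of_length_eq_dist hp).concat h0 hxy
  have h2 := hv.path_unique h1 (q.isPath_of_length_eq_dist hq)
    (by simp; omega) (by omega)
  have h3 := congrArg Walk.length h2
  simp at h3
  omega

theorem _root_.TreeLikeVtx.last_step_unique (hv : TreeLikeVtx H d r v) (hyu : H.Adj y u)
    (hxu : H.Adj x u) (hu : H.Reachable v u) (hr : H.dist v u ≤ r)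
    (hy : H.dist v y + 1 = H.dist v u) (hx : H.dist v x + 1 = H.dist v u) : y = x := by
  obtain ⟨p, hp⟩ := (hu.trans hyu.symm.reachable).exists_walk_length_eq_dist
  obtain ⟨q, hq⟩ := (hu.trans hxu.symm.reachable).exists_walk_length_eq_dist
  have h2 := hv.path_unique
    ((p.concat hyu).isPath_of_length_eq_dist (by simp; omega))
    ((q.concat hxu).isPath_of_length_eq_dist (by simp; omega))
    (by simp; omega) (by simp; omega)
  simpa using congrArg Walk.penultimate h2

theorem exists_adj_dist_add_one (hu : H.Reachable v u) (hne : v ≠ u) :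
    ∃ w, H.Adj v w ∧ H.dist w u + 1 = H.dist v u := by
  obtain ⟨p, hp⟩ := hu.exists_walk_length_eq_dist
  cases p with
  | nil => exact absurd rfl hne
  | @cons _ w _ h q =>
    refine ⟨w, h, ?_⟩
    have h1 := dist_le q
    have h2 := h.reachable.dist_triangle_left u
    rw [dist_eq_one_iff_adj.2 h] at h2
    simp at hp
    omega

variable [Fintype W]

open Classical in
/-- The vertices at distance `j + 1` from `v` and `j` from its neighbour `w`. -/
noncomputable def branch (H : SimpleGraph W) (v w : W) (j : ℕ) : Finset W :=
  {u | H.Reachable v u ∧ H.dist v u = j + 1 ∧ H.dist w u = j}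

theorem mem_branch {j : ℕ} :
    u ∈ H.branch v w j ↔ H.Reachable v u ∧ H.dist v u = j + 1 ∧ H.dist w u = j := by
  simp [branch]

theorem _root_.TreeLikeVtx.card_branch (hv : TreeLikeVtx H 4 r v) (hvw : H.Adj v w) (j : ℕ)
    (hj : j + 1 ≤ r) : (H.branch v w j).card = 3 ^ j := by
  classical
  induction j with
  | zero =>
    have : H.branch v w 0 = {w} := by
      ext u
      rw [mem_branch, Finset.mem_singleton]
      constructor
      · rintro ⟨h1, h2, h3⟩
        exact (((hvw.symm.reachable.trans h1).dist_eq_zero_iff).1 h3).symm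
      · rintro rfl
        exact ⟨hvw.reachable, by simpa using dist_eq_one_iff_adj.2 hvw, by simp⟩
    simp [this]
  | succ j ih =>
    have hU : H.branch v w (j + 1) = (H.branch v w j).biUnion
        (fun x => (H.neighborFinset x).filter (fun y => H.dist v y = j + 2)) := by
      ext u
      simp only [Finset.mem_biUnion, Finset.mem_filter, mem_neighborFinset, mem_branch]
      constructor
      · rintro ⟨h1, h2, h3⟩
        have hwu : H.Reachable w u := hvw.symm.reachable.trans h1
        have hne : u ≠ w := by
          rintro rfl
          simp at h3
        obtain ⟨x, hx, hxd⟩ := exists_adj_dist_add_one hwu.symm hne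
        rw [dist_comm, dist_comm (u := u), h3] at hxd
        have hvx : H.Reachable v x := h1.trans hx.reachable
        have e1 := hvw.reachable.dist_triangle_left x
        rw [dist_eq_one_iff_adj.2 hvw] at e1
        have e2 := hx.reachable.symm.dist_triangle_right v
        rw [dist_eq_one_iff_adj.2 hx.symm] at e2
        exact ⟨x, ⟨hvx, by omega, by omega⟩, hx.symm, h2⟩
      · rintro ⟨x, ⟨h1, h2, h3⟩, hxu, h4⟩
        have e1 := hvw.reachable.dist_triangle_left u
        rw [dist_eq_one_iff_adj.2 hvw] at e1
        have e2 := hxu.reachable.dist_triangle_right w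
        rw [dist_eq_one_iff_adj.2 hxu] at e2
        exact ⟨h1.trans hxu.reachable, h4, by omega⟩
    rw [hU, Finset.card_biUnion, Finset.sum_const_nat (m := 3), ih (by omega), pow_succ]
    · intro x hx
      obtain ⟨h1, h2, h3⟩ := mem_branch.1 hx
      have hdeg : (H.neighborFinset x).card = 4 := by
        rw [← hv.2 x h1 (by omega), Set.ncard_eq_toFinset_card']
        rfl
      obtain ⟨y, hxy, hy⟩ := exists_adj_dist_add_one (v := x) (u := v) h1.symm
        (by rintro rfl; simp at h2)
      rw [dist_comm, dist_comm (u := x)] at hy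
      have : (H.neighborFinset x).filter (fun y => H.dist v y = j + 2)
          = (H.neighborFinset x).erase y := by
        ext z
        simp only [Finset.mem_filter, mem_neighborFinset, Finset.mem_erase]
        constructor
        · rintro ⟨h5, h6⟩
          refine ⟨?_, h5⟩
          rintro rfl
          omega
        · rintro ⟨h5, h6⟩
          refine ⟨h6, ?_⟩
          have e1 := hv.dist_ne_of_adj' h6 h1 (by omega)
          rcases h6.diff_dist_adj (u := v) with e | e | e
          · omega
          · omega
          · exact absurd (hv.last_step_unique h6.symm hxy.symm h1 (by omega) (by omega) hy) h5
      rw [this, Finset.card_erase_of_mem (by simpa using hxy), hdeg]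
    · intro x hx y hy hne
      rw [Function.onFun, Finset.disjoint_left]
      intro z hz hz'
      obtain ⟨h1, h2, -⟩ := mem_branch.1 hx
      obtain ⟨h1', h2', -⟩ := mem_branch.1 hy
      simp only [Finset.mem_filter, mem_neighborFinset] at hz hz'
      exact hne (hv.last_step_unique hz.1 hz'.1 (h1.trans hz.1.reachable)
        (by omega) (by omega) (by omega))

end SimpleGraph

namespace SimpleGraph

variable {W : Type*} {H : SimpleGraph W} {r R L : ℕ} {v w x y u : W} {c : ℝ} [Fintype W]

open Classical in
/-- The vertices within distance `L` of `v`. -/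
noncomputable def closedBallFinset (H : SimpleGraph W) (v : W) (L : ℕ) : Finset W :=
  {u | H.Reachable v u ∧ H.dist v u ≤ L}

theorem mem_closedBallFinset :
    u ∈ H.closedBallFinset v L ↔ H.Reachable v u ∧ H.dist v u ≤ L := by
  simp [closedBallFinset]

theorem mem_closedBallFinset_comm :
    u ∈ H.closedBallFinset v L ↔ v ∈ H.closedBallFinset u L := by
  rw [mem_closedBallFinset, mem_closedBallFinset, dist_comm, reachable_comm]

theorem mem_closedBallFinset_trans {L' : ℕ} (h : x ∈ H.closedBallFinset v L)
    (h' : u ∈ H.closedBallFinset x L') : u ∈ H.closedBallFinset v (L + L') := by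
  rw [mem_closedBallFinset] at *
  have := h.1.dist_triangle_left u
  exact ⟨h.1.trans h'.1, by omega⟩

theorem closedBallFinset_mono {L' : ℕ} (h : L ≤ L') :
    H.closedBallFinset v L ⊆ H.closedBallFinset v L' := by
  intro u hu
  rw [mem_closedBallFinset] at *
  exact ⟨hu.1, hu.2.trans h⟩

theorem Adj.mem_closedBallFinset (h : H.Adj v w) : w ∈ H.closedBallFinset v 1 :=
  SimpleGraph.mem_closedBallFinset.2 ⟨h.reachable, (dist_eq_one_iff_adj.2 h).le⟩

open Classical in
theorem _root_.TreeLikeVtx.card_neighborFinset (hv : TreeLikeVtx H 4 r v)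
    (hx : H.Reachable v x) (hr : H.dist v x + 1 ≤ r) : (H.neighborFinset x).card = 4 := by
  rw [← hv.2 x hx hr, Set.ncard_eq_toFinset_card']
  rfl

theorem _root_.TreeLikeVtx.card_closedBallFinset_le (hv : TreeLikeVtx H 4 r v) (hL : L ≤ r) :
    (H.closedBallFinset v L).card ≤ 5 ^ L := by
  classical
  induction L with
  | zero =>
    refine (Finset.card_le_card (t := {v}) ?_).trans (by simp)
    intro u hu
    rw [mem_closedBallFinset] at hu
    exact Finset.mem_singleton.2 (hu.1.dist_eq_zero_iff.1 (Nat.le_zero.1 hu.2)).symm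
  | succ L ih =>
    have hsub : H.closedBallFinset v (L + 1) ⊆
        (H.closedBallFinset v L).biUnion (fun x => insert x (H.neighborFinset x)) := by
      intro u hu
      obtain ⟨h1, h2⟩ := mem_closedBallFinset.1 hu
      simp only [Finset.mem_biUnion, Finset.mem_insert, mem_neighborFinset,
        mem_closedBallFinset]
      by_cases huv : u = v
      · exact ⟨v, ⟨Reachable.refl v, by simp⟩, Or.inl huv⟩
      · obtain ⟨x, hx, hxd⟩ := exists_adj_dist_add_one h1.symm huv
        rw [dist_comm, dist_comm (u := u)] at hxd
        exact ⟨x, ⟨h1.trans hx.reachable, by omega⟩, Or.inr hx.symm⟩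
    refine (Finset.card_le_card hsub).trans ?_
    refine (Finset.card_biUnion_le_card_mul _ _ 5 ?_).trans ?_
    · intro x hx
      obtain ⟨h1, h2⟩ := mem_closedBallFinset.1 hx
      refine (Finset.card_insert_le _ _).trans ?_
      rw [hv.card_neighborFinset h1 (by omega)]
    · rw [pow_succ]
      exact Nat.mul_le_mul_right _ (ih (by omega))

theorem _root_.TreeLikeVtx.card_sphere_le (hv : TreeLikeVtx H 4 r v) (hR : R + 1 ≤ r)
    {s : Finset W} (hs : ∀ u ∈ s, H.Reachable v u ∧ H.dist v u = R + 1) :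
    s.card ≤ 4 * 3 ^ R := by
  classical
  have hsub : s ⊆ (H.neighborFinset v).biUnion (fun w => H.branch v w R) := by
    intro u hu
    obtain ⟨h1, h2⟩ := hs u hu
    obtain ⟨w, hw, hwd⟩ := exists_adj_dist_add_one h1 (by rintro rfl; simp at h2)
    simp only [Finset.mem_biUnion, mem_neighborFinset]
    exact ⟨w, hw, mem_branch.2 ⟨h1, h2, by omega⟩⟩
  refine (Finset.card_le_card hsub).trans ?_
  rw [← hv.card_neighborFinset (Reachable.refl v) (by simp; omega)]
  refine Finset.card_biUnion_le_card_mul _ _ _ ?_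
  intro w hw
  exact (hv.card_branch (by simpa using hw) R hR).le

open Classical in
/-- The function `u ↦ c ^ dist v u`, cut off at distance `R`. -/
noncomputable def radialVec (H : SimpleGraph W) (c : ℝ) (R : ℕ) (v : W) : EuclideanSpace ℝ W :=
  WithLp.toLp 2 fun u => if H.Reachable v u ∧ H.dist v u ≤ R then c ^ H.dist v u else 0

open Classical in
/-- The restriction of `radialVec` to the branch at `v` through its neighbour `w`. -/
noncomputable def branchVec (H : SimpleGraph W) (c : ℝ) (R : ℕ) (v w : W) :
    EuclideanSpace ℝ W :=
  WithLp.toLp 2 fun u =>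
    if H.Reachable v u ∧ H.dist v u ≤ R ∧ H.dist w u + 1 = H.dist v u then c ^ H.dist v u else 0

theorem radialVec_apply_eq_zero (hu : u ∉ H.closedBallFinset v R) : radialVec H c R v u = 0 := by
  rw [mem_closedBallFinset] at hu
  simp [radialVec, hu]

theorem radialVec_apply_self : radialVec H c R v v = 1 := by
  simp [radialVec]

theorem radialVec_ne_zero : radialVec H c R v ≠ 0 := fun h => by
  have := radialVec_apply_self (H := H) (c := c) (R := R) (v := v)
  simp [h] at this

theorem inner_single_branchVec [DecidableEq W] (w : W) :
    inner ℝ (EuclideanSpace.single v (1 : ℝ)) (branchVec H c R v w) = 0 := by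
  simp [EuclideanSpace.inner_single_left, branchVec]

theorem _root_.TreeLikeVtx.inner_branchVec (hv : TreeLikeVtx H 4 r v) (hR : R ≤ r)
    (hw : H.Adj v w) (hx : H.Adj v x) (hwx : w ≠ x) :
    inner ℝ (branchVec H c R v w) (branchVec H c R v x) = 0 := by
  rw [PiLp.inner_apply]
  refine Finset.sum_eq_zero fun u _ => ?_
  simp only [branchVec]
  split_ifs with h1 h2
  · exact absurd (hv.first_step_unique hw hx h1.1 (h1.2.1.trans hR) h1.2.2 h2.2.2) hwx
  all_goals simp

theorem _root_.TreeLikeVtx.radialVec_eq [DecidableEq W] (hv : TreeLikeVtx H 4 r v) (hR : R ≤ r)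
    {s : Finset W} (hs : ∀ w, w ∈ s ↔ H.Adj v w) :
    radialVec H c R v = EuclideanSpace.single v 1 + ∑ w ∈ s, branchVec H c R v w := by
  ext u
  simp only [PiLp.add_apply, WithLp.ofLp_sum, Finset.sum_apply, PiLp.single_apply]
  by_cases hu : H.Reachable v u ∧ H.dist v u ≤ R
  · by_cases huv : u = v
    · subst huv
      simp [radialVec, branchVec]
    · obtain ⟨w, hw, hwd⟩ := exists_adj_dist_add_one hu.1 (Ne.symm huv)
      rw [Finset.sum_eq_single_of_mem w ((hs w).2 hw)]
      · simp [radialVec, branchVec, hu, hwd, huv]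
      · intro x hx hxw
        have : ¬ (H.dist x u + 1 = H.dist v u) := fun hxd =>
          hxw (hv.first_step_unique ((hs x).1 hx) hw hu.1 (hu.2.trans hR) hxd hwd)
        simp [branchVec, this]
  · have h1 : u ≠ v := by
      rintro rfl
      simp at hu
    rw [Finset.sum_eq_zero]
    · simp [radialVec, hu, h1]
    · intro w _
      simp only [branchVec]
      rw [if_neg]
      tauto

theorem _root_.TreeLikeVtx.norm_sq_branchVec (hv : TreeLikeVtx H 4 r v) (hR : R ≤ r)
    (hw : H.Adj v w) (hc : c ^ 2 = 1 / 3) : ‖branchVec H c R v w‖ ^ 2 = R / 3 := by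
  classical
  rw [EuclideanSpace.real_norm_sq_eq]
  have h1 : ∀ u, branchVec H c R v w u ^ 2 =
      ∑ j ∈ Finset.range R, if u ∈ H.branch v w j then (1 / 3 : ℝ) ^ (j + 1) else 0 := by
    intro u
    simp only [branchVec, mem_branch]
    split_ifs with h
    · obtain ⟨ha, hb, hd⟩ := h
      rw [Finset.sum_eq_single_of_mem (H.dist w u) (by simp; omega), if_pos ⟨ha, hd.symm, rfl⟩,
        ← pow_mul, mul_comm, pow_mul, hc, hd]
      intro j _ hj
      rw [if_neg]
      rintro ⟨-, -, h3⟩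
      exact hj h3.symm
    · rw [Finset.sum_eq_zero]
      · simp
      · intro j hj
        rw [if_neg]
        rintro ⟨h1, h2, h3⟩
        simp at hj
        exact h ⟨h1, by omega, by omega⟩
  simp_rw [h1]
  rw [Finset.sum_comm]
  have h2 : ∀ j ∈ Finset.range R,
      (∑ u, if u ∈ H.branch v w j then (1 / 3 : ℝ) ^ (j + 1) else 0) = 1 / 3 := by
    intro j hj
    simp at hj
    rw [← Finset.sum_filter, Finset.sum_const, Finset.filter_mem_eq_inter, Finset.univ_inter,
      hv.card_branch hw j (by omega), nsmul_eq_mul, pow_succ]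
    push_cast
    rw [← mul_assoc, ← mul_pow]
    norm_num
  rw [Finset.sum_congr rfl h2]
  simp
  ring

theorem _root_.TreeLikeVtx.norm_sq_radialVec_sub_le (hv : TreeLikeVtx H 4 r v)
    (hR : R + 2 ≤ r) (hw : H.Adj v w) (hc : c ^ 2 = 1 / 3) :
    ‖radialVec H c (R + 1) w -
      c • (radialVec H c (R + 1) v + (2 : ℝ) • branchVec H c (R + 1) v w)‖ ^ 2 ≤ 2 := by
  classical
  set s : Finset W := {u | H.Reachable v u ∧ H.dist v u = R + 1} with hs
  rw [EuclideanSpace.real_norm_sq_eq]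
  have hpow : ∀ j : ℕ, (c ^ j) ^ 2 = (1 / 3 : ℝ) ^ j := fun j => by
    rw [← pow_mul, mul_comm, pow_mul, hc]
  have h1 : ∀ u, (radialVec H c (R + 1) w -
      c • (radialVec H c (R + 1) v + (2 : ℝ) • branchVec H c (R + 1) v w)) u ^ 2 ≤
      (if u ∈ H.branch v w (R + 1) then (1 / 3 : ℝ) ^ (R + 1) else 0) +
        (if u ∈ s then (1 / 3 : ℝ) ^ (R + 2) else 0) := by
    intro u
    have hnn : 0 ≤ (if u ∈ H.branch v w (R + 1) then (1 / 3 : ℝ) ^ (R + 1) else 0) +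
        (if u ∈ s then (1 / 3 : ℝ) ^ (R + 2) else 0) := by positivity
    by_cases hu : H.Reachable v u
    · have hwu : H.Reachable w u := hw.symm.reachable.trans hu
      have e1 := hw.reachable.dist_triangle_left u
      have e2 := hw.symm.reachable.dist_triangle_left u
      rw [dist_eq_one_iff_adj.2 hw] at e1
      rw [dist_eq_one_iff_adj.2 hw.symm] at e2
      simp only [PiLp.sub_apply, PiLp.smul_apply, PiLp.add_apply, smul_eq_mul, radialVec,
        branchVec, hu, hwu, true_and, mem_branch, hs, Finset.mem_filter, Finset.mem_univ]
      by_cases h2 : H.dist v u ≤ R + 1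
      · have h3 := hv.dist_ne_of_adj hw hu (by omega)
        by_cases h4 : H.dist w u + 1 = H.dist v u
        · rw [if_pos (by omega), if_pos h2, if_pos ⟨h2, h4⟩, ← h4]
          have : c ^ H.dist w u - c * (c ^ (H.dist w u + 1) + 2 * c ^ (H.dist w u + 1)) = 0 := by
            have : c * (c ^ (H.dist w u + 1) + 2 * c ^ (H.dist w u + 1)) =
              3 * c ^ 2 * c ^ H.dist w u := by ring
            rw [this, hc]
            ring
          rw [this, zero_pow two_ne_zero]
          positivity
        · have h5 : H.dist w u = H.dist v u + 1 := by omega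
          by_cases h6 : H.dist v u = R + 1
          · rw [if_neg (by omega), if_pos h2, if_neg (by omega), if_neg (by omega), if_pos h6, h6]
            rw [← hpow]
            ring_nf
            rfl
          · rw [if_pos (by omega), if_pos h2, if_neg (by omega), if_neg (by omega), if_neg h6, h5]
            ring_nf
            rfl
      · by_cases h4 : H.dist w u ≤ R + 1
        · rw [if_pos h4, if_neg h2, if_neg (by omega), if_pos (by omega), if_neg (by omega),
            ← hpow, show H.dist w u = R + 1 by omega]
          simp
        · rw [if_neg h4, if_neg h2, if_neg (by omega), if_neg (by omega), if_neg (by omega)]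
          simp
    · have hwu : ¬ H.Reachable w u := fun h => hu (hw.reachable.trans h)
      simpa [radialVec, branchVec, hu, hwu] using hnn
  refine (Finset.sum_le_sum fun u _ => h1 u).trans ?_
  rw [Finset.sum_add_distrib, ← Finset.sum_filter, ← Finset.sum_filter, Finset.sum_const,
    Finset.sum_const, Finset.filter_mem_eq_inter, Finset.univ_inter, Finset.filter_mem_eq_inter,
    Finset.univ_inter, hv.card_branch hw (R + 1) (by omega), nsmul_eq_mul, nsmul_eq_mul]
  have h3 : (s.card : ℝ) ≤ 4 * 3 ^ R := by
    have := hv.card_sphere_le (R := R) (by omega) (s := s) (fun u hu => by simpa [hs] using hu)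
    exact_mod_cast this
  have h4 : (3 : ℝ) ^ R * (1 / 3) ^ R = 1 := by rw [← mul_pow]; norm_num
  have h5 : (0 : ℝ) ≤ (1 / 3) ^ (R + 2) := by positivity
  have h6 := mul_le_mul_of_nonneg_right h3 h5
  push_cast
  have h7 : (4 * 3 ^ R : ℝ) * (1 / 3) ^ (R + 2) = 4 / 9 * (3 ^ R * (1 / 3) ^ R) := by ring
  have h8 : (3 : ℝ) ^ (R + 1) * (1 / 3) ^ (R + 1) = 3 ^ R * (1 / 3) ^ R := by ring
  rw [h7] at h6
  rw [h8]
  linarith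

end SimpleGraph

namespace ProbabilityTheory

open MeasureTheory

section

variable {E : Type*} [NormedAddCommGroup E] [InnerProductSpace ℝ E] [FiniteDimensional ℝ E]
  [MeasurableSpace E] [BorelSpace E]
  {F : Type*} [NormedAddCommGroup F] [InnerProductSpace ℝ F] [FiniteDimensional ℝ F]
  [MeasurableSpace F] [BorelSpace F] {ι : Type*} [Fintype ι]

/-- The joint law of linear functionals under a standard Gaussian depends only on their
Gram matrix. -/
theorem stdGaussian_map_inner_eq {a : ι → E} {b : ι → F}
    (h : ∀ i j, inner ℝ (a i) (a j) = inner ℝ (b i) (b j)) :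
    (stdGaussian E).map (fun z i => inner ℝ (a i) z) =
      (stdGaussian F).map (fun z i => inner ℝ (b i) z) := by
  classical
  have e1 : (fun z i => inner ℝ (a i) z) = ⇑(ContinuousLinearMap.pi fun i => innerSL ℝ (a i)) := by
    ext z i; simp
  have e2 : (fun z i => inner ℝ (b i) z) = ⇑(ContinuousLinearMap.pi fun i => innerSL ℝ (b i)) := by
    ext z i; simp
  rw [e1, e2]
  apply Measure.ext_of_charFunDual
  ext L
  rw [charFunDual_map, charFunDual_map, charFunDual_stdGaussian, charFunDual_stdGaussian]
  have hL : ∀ x : ι → ℝ, L x = ∑ i, x i * L (Pi.single i 1) := by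
    intro x
    conv_lhs => rw [← Finset.univ_sum_single x]
    rw [map_sum]
    refine Finset.sum_congr rfl fun i _ => ?_
    rw [show (Pi.single i (x i) : ι → ℝ) = x i • Pi.single i 1 by
      rw [← Pi.single_smul, smul_eq_mul, mul_one], map_smul, smul_eq_mul]
  have h1 : L.comp (ContinuousLinearMap.pi fun i => innerSL ℝ (a i)) =
      innerSL ℝ (∑ i, L (Pi.single i 1) • a i) := by
    ext z
    simp [hL (fun i => inner ℝ (a i) z), mul_comm]
  have h2 : L.comp (ContinuousLinearMap.pi fun i => innerSL ℝ (b i)) =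
      innerSL ℝ (∑ i, L (Pi.single i 1) • b i) := by
    ext z
    simp [hL (fun i => inner ℝ (b i) z), mul_comm]
  have h3 : ‖∑ i, L (Pi.single i 1) • a i‖ ^ 2 = ‖∑ i, L (Pi.single i 1) • b i‖ ^ 2 := by
    rw [← real_inner_self_eq_norm_sq, ← real_inner_self_eq_norm_sq]
    simp only [sum_inner, inner_sum, real_inner_smul_left, real_inner_smul_right, h]
  rw [h1, h2, innerSL_apply_norm, innerSL_apply_norm,
    (sq_eq_sq₀ (norm_nonneg _) (norm_nonneg _)).1 h3]

theorem stdGaussian_real_inner_eq {a : ι → E} {b : ι → F}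
    (h : ∀ i j, inner ℝ (a i) (a j) = inner ℝ (b i) (b j)) {S : Set (ι → ℝ)}
    (hS : MeasurableSet S) :
    (stdGaussian E).real {z | (fun i => inner ℝ (a i) z) ∈ S} =
      (stdGaussian F).real {z | (fun i => inner ℝ (b i) z) ∈ S} := by
  have h1 := congrArg (fun μ : Measure (ι → ℝ) => μ.real S) (stdGaussian_map_inner_eq h)
  beta_reduce at h1
  rwa [map_measureReal_apply (by fun_prop) hS, map_measureReal_apply (by fun_prop) hS] at h1

theorem stdGaussian_real_pos_nonpos_eq {a a' : E} {b b' : F} (h : ‖a‖ = ‖b‖) (h' : ‖a'‖ = ‖b'‖)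
    (hi : inner ℝ a a' = inner ℝ b b') :
    (stdGaussian E).real {z | 0 < inner ℝ a z ∧ inner ℝ a' z ≤ 0} =
      (stdGaussian F).real {z | 0 < inner ℝ b z ∧ inner ℝ b' z ≤ 0} := by
  have := stdGaussian_real_inner_eq (a := ![a, a']) (b := ![b, b'])
    (S := {x | 0 < x 0 ∧ x 1 ≤ 0}) ?_ ?_
  · simpa using this
  · intro i j
    fin_cases i <;> fin_cases j <;>
      simp [h, h', hi, real_inner_comm a a', real_inner_comm b b']
  · exact (measurableSet_lt measurable_const (measurable_pi_apply 0)).inter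
      (measurableSet_le (measurable_pi_apply 1) measurable_const)

theorem stdGaussian_map_inner (a : E) :
    (stdGaussian E).map (fun z => inner ℝ a z) = gaussianReal 0 (‖a‖ ^ 2).toNNReal := by
  have := IsGaussian.map_eq_gaussianReal (μ := stdGaussian E) (innerSL ℝ a)
  rw [variance_dual_stdGaussian, integral_strongDual_stdGaussian, innerSL_apply_norm] at this
  exact this

theorem ae_inner_ne_zero {a : E} (ha : a ≠ 0) : ∀ᵐ z ∂stdGaussian E, inner ℝ a z ≠ 0 := by
  have hv : (‖a‖ ^ 2).toNNReal ≠ 0 := by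
    have : 0 < ‖a‖ := norm_pos_iff.2 ha
    simpa using ha
  have := nullSingletonClass_gaussianReal (μ := 0) hv
  have h0 : ∀ᵐ x ∂(stdGaussian E).map (fun z => inner ℝ a z), x ≠ (0 : ℝ) := by
    rw [stdGaussian_map_inner, ae_iff]
    simp
  exact ae_of_ae_map (p := fun x => x ≠ 0) (by fun_prop) h0

theorem stdGaussian_real_le_abs_inner_le (e : E) {t : ℝ} (ht : 0 < t) :
    (stdGaussian E).real {z | t ≤ |inner ℝ e z|} ≤ ‖e‖ ^ 2 / t ^ 2 := by
  have h1 := meas_ge_le_variance_div_sq (μ := stdGaussian E) (X := innerSL ℝ e)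
    (IsGaussian.memLp_dual _ (innerSL ℝ e) 2 (by simp)) ht
  rw [variance_dual_stdGaussian, integral_strongDual_stdGaussian, innerSL_apply_norm] at h1
  simp only [innerSL_apply_apply, sub_zero] at h1
  refine ENNReal.toReal_le_of_le_ofReal (by positivity) ?_
  exact h1

end

/-- The vector at angle `s` on the unit circle. -/
noncomputable def circleVec (s : ℝ) : EuclideanSpace ℝ (Fin 2) := !₂[cos s, sin s]

theorem inner_circleVec (s : ℝ) (z : EuclideanSpace ℝ (Fin 2)) :
    inner ℝ (circleVec s) z = cos s * z 0 + sin s * z 1 := by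
  simp [circleVec, PiLp.inner_apply, mul_comm]

theorem inner_circleVec_circleVec (s t : ℝ) :
    inner ℝ (circleVec s) (circleVec t) = cos (t - s) := by
  rw [inner_circleVec, cos_sub]
  simp [circleVec]
  ring

theorem norm_circleVec (s : ℝ) : ‖circleVec s‖ = 1 := by
  have := real_inner_self_eq_norm_sq (circleVec s)
  rw [inner_circleVec_circleVec, sub_self, cos_zero] at this
  exact (sq_eq_sq₀ (norm_nonneg _) zero_le_one).1 (by linarith)

/-- The standard Gaussian measure of the planar wedge of angle `θ` on which one linear
functional is positive and its rotation by `θ` is not. -/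
noncomputable def wedgeMeasure (θ : ℝ) : ℝ :=
  (stdGaussian (EuclideanSpace ℝ (Fin 2))).real
    {z | 0 < inner ℝ (circleVec 0) z ∧ inner ℝ (circleVec θ) z ≤ 0}

theorem stdGaussian_wedge (s t : ℝ) : (stdGaussian (EuclideanSpace ℝ (Fin 2))).real
    {z | 0 < inner ℝ (circleVec s) z ∧ inner ℝ (circleVec t) z ≤ 0} = wedgeMeasure (t - s) :=
  stdGaussian_real_pos_nonpos_eq (by simp [norm_circleVec]) (by simp [norm_circleVec])
    (by simp [inner_circleVec_circleVec])

theorem wedgeMeasure_add_le (α β : ℝ) :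
    wedgeMeasure (α + β) ≤ wedgeMeasure α + wedgeMeasure β := by
  rw [← sub_zero α, ← stdGaussian_wedge, show β = (α - 0 + β) - α by ring, ← stdGaussian_wedge]
  refine (measureReal_mono ?_).trans (measureReal_union_le _ _)
  rintro z ⟨h1, h2⟩
  by_cases h : inner ℝ (circleVec α) z ≤ 0
  · exact Or.inl ⟨h1, h⟩
  · exact Or.inr ⟨not_le.1 h, by simpa using h2⟩

theorem measurableSet_wedge (s t : ℝ) : MeasurableSet
    {z : EuclideanSpace ℝ (Fin 2) | 0 < inner ℝ (circleVec s) z ∧ inner ℝ (circleVec t) z ≤ 0} := by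
  rw [Set.ofPred_and]
  exact (measurableSet_lt measurable_const (by fun_prop)).inter
    (measurableSet_le (by fun_prop) measurable_const)

theorem le_wedgeMeasure_add {α β : ℝ} (hα : 0 < α) (hβ : 0 < β) (h : α + β < π) :
    wedgeMeasure α + wedgeMeasure β ≤ wedgeMeasure (α + β) := by
  conv_lhs => rw [← sub_zero α, ← stdGaussian_wedge, show β = (α + β) - α by ring,
    ← stdGaussian_wedge, ← measureReal_union (by
      rw [Set.disjoint_left]
      rintro z ⟨-, h1⟩ ⟨h2, -⟩
      linarith) (measurableSet_wedge _ _)]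
  refine measureReal_mono ?_
  have hsα : 0 < sin α := sin_pos_of_pos_of_lt_pi hα (by linarith)
  have hsβ : 0 < sin β := sin_pos_of_pos_of_lt_pi hβ (by linarith)
  have hs : 0 < sin (α + β) := sin_pos_of_pos_of_lt_pi (by linarith) h
  have key : ∀ z : EuclideanSpace ℝ (Fin 2), inner ℝ (circleVec α) z * sin (α + β) =
      inner ℝ (circleVec 0) z * sin β + inner ℝ (circleVec (α + β)) z * sin α := by
    intro z
    rw [inner_circleVec, inner_circleVec, inner_circleVec, sin_add, cos_add, cos_zero, sin_zero]
    linear_combination (z 0) * sin β * (sin_sq_add_cos_sq α)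
  rintro z (⟨h1, h2⟩ | ⟨h1, h2⟩)
  · refine ⟨h1, ?_⟩
    by_contra! h3
    nlinarith [key z, mul_pos h1 hsβ, mul_pos h3 hsα, mul_nonneg (neg_nonneg.2 h2) hs.le]
  · refine ⟨?_, h2⟩
    by_contra! h3
    nlinarith [key z, mul_pos h1 hs, mul_nonneg (neg_nonneg.2 h3) hsβ.le,
      mul_nonneg (neg_nonneg.2 h2) hsα.le]

theorem wedgeMeasure_nonneg (θ : ℝ) : 0 ≤ wedgeMeasure θ := measureReal_nonneg

theorem wedgeMeasure_mono {α β : ℝ} (hα : 0 < α) (h : α ≤ β) (hβ : β < π) :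
    wedgeMeasure α ≤ wedgeMeasure β := by
  rcases h.eq_or_lt with rfl | h
  · rfl
  · have := le_wedgeMeasure_add hα (sub_pos.2 h) (by linarith)
    rw [add_sub_cancel] at this
    linarith [wedgeMeasure_nonneg (β - α)]

theorem wedgeMeasure_le_half (θ : ℝ) : wedgeMeasure θ ≤ 1 / 2 := by
  have h1 : wedgeMeasure θ = wedgeMeasure (0 - θ) :=
    stdGaussian_real_pos_nonpos_eq rfl (by simp [norm_circleVec])
      (by simp [inner_circleVec_circleVec])
  have h2 : wedgeMeasure (θ - 0) + wedgeMeasure (0 - θ) ≤ 1 := by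
    rw [← stdGaussian_wedge, ← stdGaussian_wedge, ← measureReal_union (by
      rw [Set.disjoint_left]
      rintro z ⟨h1, -⟩ ⟨-, h2⟩
      linarith) (measurableSet_wedge _ _)]
    exact measureReal_le_one
  rw [sub_zero, ← h1] at h2
  linarith

theorem nsmul_wedgeMeasure_le {θ : ℝ} (hθ : 0 < θ) (n : ℕ) (hn : (n + 1) * θ < π) :
    (n + 1) * wedgeMeasure θ ≤ wedgeMeasure ((n + 1) * θ) := by
  induction n with
  | zero => simp
  | succ n ih =>
    push_cast at hn ⊢
    have h1 := ih (by nlinarith)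
    have h2 := le_wedgeMeasure_add (α := (n + 1) * θ) (β := θ) (by positivity) hθ (by linarith)
    rw [show ((n : ℝ) + 1 + 1) * θ = (n + 1) * θ + θ by ring]
    linarith

theorem wedgeMeasure_nsmul_le (θ : ℝ) (n : ℕ) :
    wedgeMeasure ((n + 1) * θ) ≤ (n + 1) * wedgeMeasure θ := by
  induction n with
  | zero => simp
  | succ n ih =>
    have h2 := wedgeMeasure_add_le ((n + 1) * θ) θ
    push_cast
    rw [show ((n : ℝ) + 1 + 1) * θ = (n + 1) * θ + θ by ring]
    linarith

theorem wedgeMeasure_le_div {θ : ℝ} {k m : ℕ} (hθ : 0 < θ) (h : θ ≤ (k + 1) * (π / (m + 2)))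
    (hkm : k ≤ m) : wedgeMeasure θ ≤ (k + 1) / (2 * (m + 1)) := by
  have hm : (0 : ℝ) < m + 2 := by positivity
  have hpm : 0 < π / (m + 2) := by positivity
  have hkm' : (k : ℝ) ≤ m := by exact_mod_cast hkm
  have hmul : π / (m + 2) * (m + 2) = π := div_mul_cancel₀ _ hm.ne'
  have h1 := wedgeMeasure_mono hθ h (by nlinarith)
  have h2 := wedgeMeasure_nsmul_le (π / (m + 2)) k
  have h3 := nsmul_wedgeMeasure_le hpm m (by nlinarith)
  have h4 := wedgeMeasure_le_half ((m + 1) * (π / (m + 2)))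
  have h5 : (m + 1) * wedgeMeasure (π / (m + 2)) ≤ 1 / 2 := h3.trans h4
  rw [le_div_iff₀ (by positivity)]
  have h6 : (0 : ℝ) ≤ k + 1 := by positivity
  nlinarith [h1.trans h2]

/-- For vectors at angle close to `π / 6`, the corresponding standard Gaussian half-spaces
differ on each side by little more than `1 / 12`. -/
theorem exists_stdGaussian_real_pos_nonpos_le {ε : ℝ} (hε : 0 < ε) :
    ∃ ρ < √3 / 2, 0 < ρ ∧ ∀ {E : Type} [NormedAddCommGroup E] [InnerProductSpace ℝ E]
      [FiniteDimensional ℝ E] [MeasurableSpace E] [BorelSpace E] {a b : E}, a ≠ 0 → ‖a‖ = ‖b‖ →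
      ρ * ‖a‖ ^ 2 ≤ inner ℝ a b →
      (stdGaussian E).real {z | 0 < inner ℝ a z ∧ inner ℝ b z ≤ 0} ≤ 1 / 12 + ε := by
  obtain ⟨M, hM⟩ := exists_nat_gt (1 / ε)
  have hM0 : (0 : ℝ) < M := lt_trans (by positivity) hM
  have hM1 : (1 : ℝ) ≤ M := by exact_mod_cast (Nat.cast_pos.1 hM0)
  set θ₀ : ℝ := ((M + 2 : ℕ) + 1) * (π / ((6 * M + 10 : ℕ) + 2)) with hθ₀
  have hpi := pi_pos
  have e : θ₀ = π / 6 + π / (6 * M + 12) := by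
    rw [hθ₀]
    push_cast
    field_simp
    ring
  have h1 : 0 < π / (6 * M + 12) := by positivity
  have h2 : π / (6 * M + 12) < π / 6 := by
    apply div_lt_div_of_pos_left hpi <;> linarith
  refine ⟨cos θ₀, ?_, cos_pos_of_mem_Ioo ⟨by linarith, by linarith⟩, ?_⟩
  · rw [← cos_pi_div_six]
    exact cos_lt_cos_of_nonneg_of_le_pi (by linarith) (by linarith) (by linarith)
  intro E _ _ _ _ _ a b ha hab hρ
  have hN : 0 < ‖a‖ := norm_pos_iff.2 ha
  have hc1 : inner ℝ a b ≤ ‖a‖ ^ 2 := by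
    have := real_inner_le_norm a b
    rwa [← hab, ← sq] at this
  have hc0 : cos θ₀ ≤ inner ℝ a b / ‖a‖ ^ 2 := by
    rwa [le_div_iff₀ (by positivity)]
  set θ := arccos (inner ℝ a b / ‖a‖ ^ 2) with hθ
  have hcos : cos θ * ‖a‖ ^ 2 = inner ℝ a b := by
    rw [hθ, cos_arccos ((neg_one_le_cos θ₀).trans hc0) ((div_le_one (by positivity)).2 hc1),
      div_mul_cancel₀ _ (by positivity)]
  have hP : (stdGaussian E).real {z | 0 < inner ℝ a z ∧ inner ℝ b z ≤ 0} = wedgeMeasure θ := by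
    rw [stdGaussian_real_pos_nonpos_eq (b := ‖a‖ • circleVec 0) (b' := ‖a‖ • circleVec θ)
      (by simp [norm_smul, norm_circleVec]) (by simp [norm_smul, norm_circleVec, hab])
      (by rw [real_inner_smul_left, real_inner_smul_right, inner_circleVec_circleVec, ← hcos]
          ring_nf)]
    simp [wedgeMeasure, real_inner_smul_left, hN, mul_pos_iff_of_pos_left, mul_nonpos_iff,
      hN.le, not_le.2 hN]
  have hle : θ ≤ θ₀ := by
    rw [← arccos_cos (x := θ₀) (by linarith) (by linarith)]
    exact arccos_le_arccos hc0
  rw [hP]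
  rcases (arccos_nonneg _ : 0 ≤ θ).eq_or_lt with h0 | h0
  · have : wedgeMeasure 0 = 0 := by
      have : {z : EuclideanSpace ℝ (Fin 2) |
          0 < inner ℝ (circleVec 0) z ∧ inner ℝ (circleVec 0) z ≤ 0} = ∅ := by
        ext z
        simp
      rw [wedgeMeasure, this, measureReal_empty]
    rw [hθ, ← h0, this]
    positivity
  · refine (wedgeMeasure_le_div h0 hle (by omega)).trans ?_
    have hM' : 1 < M * ε := by rwa [div_lt_iff₀ hε] at hM
    rw [div_le_iff₀ (by positivity)]
    push_cast
    nlinarith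

end ProbabilityTheory

namespace ProbabilityTheory

open MeasureTheory

/-- The values of a standard Gaussian on orthonormal vectors fall in a given nondegenerate box
with a positive probability, which depends only on the box. -/
theorem exists_stdGaussian_real_box {ι : Type} [Fintype ι] {l u : ι → ℝ} (h : ∀ i, l i < u i) :
    ∃ p > 0, ∀ {E : Type} [NormedAddCommGroup E] [InnerProductSpace ℝ E]
      [FiniteDimensional ℝ E] [MeasurableSpace E] [BorelSpace E] {g : ι → E}, Orthonormal ℝ g →
      (stdGaussian E).real {z | ∀ i, inner ℝ (g i) z ∈ Set.Ioo (l i) (u i)} = p := by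
  classical
  have hbox : MeasurableSet (Set.univ.pi fun i => Set.Ioo (l i) (u i)) :=
    MeasurableSet.univ_pi fun i => measurableSet_Ioo
  refine ⟨(Measure.pi fun _ : ι => gaussianReal 0 1).real
    (Set.univ.pi fun i => Set.Ioo (l i) (u i)), ?_, ?_⟩
  · rw [measureReal_def, Measure.pi_pi, ENNReal.toReal_prod]
    refine Finset.prod_pos fun i _ => ENNReal.toReal_pos (fun h0 => ?_) (measure_ne_top _ _)
    have := gaussianReal_absolutelyContinuous' 0 one_ne_zero h0
    rw [Real.volume_Ioo, ENNReal.ofReal_eq_zero] at this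
    linarith [h i]
  · intro E _ _ _ _ _ g hg
    have h1 := stdGaussian_real_inner_eq (a := g) (b := EuclideanSpace.basisFun ι ℝ)
      (fun i j => by
        rw [orthonormal_iff_ite.1 hg, orthonormal_iff_ite.1 (EuclideanSpace.basisFun ι ℝ).orthonormal])
      hbox
    have h2 : ∀ z : EuclideanSpace ℝ ι,
        (fun i => inner ℝ (EuclideanSpace.basisFun ι ℝ i) z) = WithLp.ofLp z := by
      intro z
      ext i
      rw [EuclideanSpace.basisFun_inner]
    simp only [h2] at h1
    simp only [Set.mem_univ_pi] at h1
    rw [h1, ← map_pi_eq_stdGaussian, map_measureReal_apply (by fun_prop)]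
    · congr 1
      ext x
      simp
    · simpa [Set.pi, Set.preimage] using hbox.preimage (f := WithLp.ofLp (p := 2) (V := ι → ℝ))
        (by fun_prop)

variable {W : Type*} [Fintype W] {f g : EuclideanSpace ℝ W → ℝ} {A : Finset W}

/-- Odd functions of some coordinates are orthogonal to functions of the other coordinates. -/
theorem integral_mul_eq_zero_of_odd
    (hf : ∀ z z' : EuclideanSpace ℝ W, (∀ u ∈ A, z u = z' u) → f z = f z')
    (hg : ∀ z z' : EuclideanSpace ℝ W, (∀ u ∉ A, z u = z' u) → g z = g z')
    (hodd : ∀ᵐ z ∂stdGaussian (EuclideanSpace ℝ W), f (-z) = -f z) :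
    ∫ z, f z * g z ∂stdGaussian (EuclideanSpace ℝ W) = 0 := by
  classical
  let e : EuclideanSpace ℝ W ≃ₗᵢ[ℝ] EuclideanSpace ℝ W :=
    LinearIsometryEquiv.piLpCongrRight 2 fun u =>
      if u ∈ A then LinearIsometryEquiv.neg ℝ else LinearIsometryEquiv.refl ℝ ℝ
  have he : ∀ z u, e z u = if u ∈ A then -z u else z u := by
    intro z u
    simp only [e, LinearIsometryEquiv.piLpCongrRight_apply]
    split_ifs <;> simp
  have h1 : ∀ᵐ z ∂stdGaussian (EuclideanSpace ℝ W), f (e z) * g (e z) = -(f z * g z) := by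
    filter_upwards [hodd] with z hz
    rw [hf (e z) (-z) fun u hu => by simp [he, hu], hg (e z) z fun u hu => by simp [he, hu], hz]
    ring
  have h2 : ∫ z, f z * g z ∂stdGaussian (EuclideanSpace ℝ W) =
      ∫ z, f (e z) * g (e z) ∂stdGaussian (EuclideanSpace ℝ W) := by
    conv_lhs => rw [← stdGaussian_map e]
    exact e.toHomeomorph.measurableEmbedding.integral_map _
  rw [integral_congr_ae h1, integral_neg] at h2
  linarith

/-- A second moment bound for sums of bounded odd functions with local dependence. -/
theorem integral_sum_sq_le {s : Finset W} {f : W → EuclideanSpace ℝ W → ℝ} {A : W → Finset W}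
    (hmeas : ∀ u, Measurable (f u)) (hbdd : ∀ u z, |f u z| ≤ 1)
    (hf : ∀ u, ∀ z z' : EuclideanSpace ℝ W, (∀ x ∈ A u, z x = z' x) → f u z = f u z')
    (hodd : ∀ u, ∀ᵐ z ∂stdGaussian (EuclideanSpace ℝ W), f u (-z) = -f u z)
    {D : ℕ} {T : W → Finset W} (hT : ∀ u ∈ s, (T u).card ≤ D)
    (hdisj : ∀ u ∈ s, ∀ v ∈ s, v ∉ T u → Disjoint (A u) (A v)) :
    ∫ z, (∑ u ∈ s, f u z) ^ 2 ∂stdGaussian (EuclideanSpace ℝ W) ≤ s.card * D := by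
  classical
  have hb : ∀ u v z, ‖f u z * f v z‖ ≤ 1 := fun u v z => by
    rw [norm_mul]
    exact mul_le_one₀ (hbdd u z) (norm_nonneg _) (hbdd v z)
  have hInt : ∀ u v, Integrable (fun z => f u z * f v z) (stdGaussian (EuclideanSpace ℝ W)) :=
    fun u v => .of_bound ((hmeas u).mul (hmeas v)).aestronglyMeasurable 1
      (ae_of_all _ (hb u v))
  simp_rw [sq, Finset.sum_mul_sum]
  rw [integral_finsetSum _ fun u _ => integrable_finsetSum _ fun v _ => hInt u v]
  rw [← nsmul_eq_mul]
  refine Finset.sum_le_card_nsmul _ _ _ fun u hu => ?_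
  rw [integral_finsetSum _ fun v _ => hInt u v]
  have h1 : ∀ v ∈ s, ∫ z, f u z * f v z ∂stdGaussian (EuclideanSpace ℝ W) ≤
      if v ∈ T u then 1 else 0 := by
    intro v hv
    split_ifs with h
    · refine (le_abs_self _).trans ((norm_integral_le_of_norm_le_const
        (ae_of_all _ (hb u v))).trans ?_)
      simp
    · refine (integral_mul_eq_zero_of_odd (hf u) (fun z z' hz => hf v z z' fun x hx =>
        hz x fun hx' => ?_) (hodd u)).le
      exact Finset.disjoint_left.1 (hdisj u hu v hv h) hx' hx
  refine (Finset.sum_le_sum h1).trans ?_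
  rw [← Finset.sum_filter, Finset.sum_const, nsmul_eq_mul, mul_one]
  refine Nat.cast_le.2 ((Finset.card_le_card ?_).trans (hT u hu))
  intro v hv
  exact (Finset.mem_filter.1 hv).2

end ProbabilityTheory

/-- The sign of a real number, with the sign of `0` taken to be `-1`. -/
noncomputable def spin (x : ℝ) : ℝ := if 0 < x then 1 else -1

theorem spin_sq (x : ℝ) : spin x ^ 2 = 1 := by
  unfold spin; split_ifs <;> norm_num

theorem abs_spin (x : ℝ) : |spin x| = 1 := by
  unfold spin; split_ifs <;> norm_num

theorem spin_of_pos {x : ℝ} (h : 0 < x) : spin x = 1 := if_pos h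

theorem spin_of_nonpos {x : ℝ} (h : x ≤ 0) : spin x = -1 := if_neg h.not_gt

theorem spin_mul_of_sq_eq_one {σ x : ℝ} (hσ : σ ^ 2 = 1) (hx : x ≠ 0) :
    spin (σ * x) = σ * spin x := by
  rcases sq_eq_one_iff.1 hσ with rfl | rfl <;> rcases hx.lt_or_gt with h | h
  all_goals
    first
    | rw [spin_of_pos h]
    | rw [spin_of_nonpos h.le]
  · rw [one_mul, spin_of_nonpos h.le, one_mul]
  · rw [one_mul, spin_of_pos h, one_mul]
  · rw [spin_of_pos (by linarith)]; norm_num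
  · rw [spin_of_nonpos (by linarith)]; norm_num

theorem spin_neg {x : ℝ} (hx : x ≠ 0) : spin (-x) = -spin x := by
  simpa using spin_mul_of_sq_eq_one (σ := -1) (by norm_num) hx

theorem measurable_spin : Measurable spin :=
  Measurable.ite measurableSet_Ioi measurable_const measurable_const

namespace SimpleGraph

open MeasureTheory ProbabilityTheory

variable {W : Type} [Fintype W] {H : SimpleGraph W} {r R : ℕ} {v w : W} {c σ : ℝ}

theorem _root_.TreeLikeVtx.norm_sq_radialVec (hv : TreeLikeVtx H 4 r v) (hR : R ≤ r) (hr : 1 ≤ r)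
    (hc : c ^ 2 = 1 / 3) : ‖radialVec H c R v‖ ^ 2 = 1 + 4 * (R / 3) := by
  classical
  have hs : ∀ w, w ∈ H.neighborFinset v ↔ H.Adj v w := by simp
  have h1 : ‖∑ w ∈ H.neighborFinset v, branchVec H c R v w‖ ^ 2 = 4 * (R / 3) := by
    rw [← real_inner_self_eq_norm_sq, sum_inner]
    have : ∀ x ∈ H.neighborFinset v, inner ℝ (branchVec H c R v x)
        (∑ w ∈ H.neighborFinset v, branchVec H c R v w) = R / 3 := by
      intro x hx
      rw [inner_sum, Finset.sum_eq_single_of_mem x hx, real_inner_self_eq_norm_sq,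
        hv.norm_sq_branchVec hR ((hs x).1 hx) hc]
      intro w hw hwx
      exact hv.inner_branchVec hR ((hs x).1 hx) ((hs w).1 hw) hwx.symm
    rw [Finset.sum_congr rfl this, Finset.sum_const, hv.card_neighborFinset (Reachable.refl v)
      (by simpa using hr)]
    simp
  rw [hv.radialVec_eq hR hs, norm_add_sq_real, h1, inner_sum,
    Finset.sum_eq_zero fun w _ => inner_single_branchVec w]
  simp

theorem _root_.TreeLikeVtx.inner_radialVec_branchVec (hv : TreeLikeVtx H 4 r v) (hR : R ≤ r)
    (hc : c ^ 2 = 1 / 3) (hw : H.Adj v w) :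
    inner ℝ (radialVec H c R v) (branchVec H c R v w) = R / 3 := by
  classical
  have hs : ∀ w, w ∈ H.neighborFinset v ↔ H.Adj v w := by simp
  rw [hv.radialVec_eq hR hs, inner_add_left, inner_single_branchVec, sum_inner,
    Finset.sum_eq_single_of_mem w ((hs w).2 hw), real_inner_self_eq_norm_sq,
    hv.norm_sq_branchVec hR hw hc, zero_add]
  intro x hx hwx
  exact hv.inner_branchVec hR ((hs x).1 hx) hw hwx

theorem div_sqrt_three_sq (hσ : σ ^ 2 = 1) : (σ / √3) ^ 2 = 1 / 3 := by
  rw [div_pow, hσ, sq_sqrt (by norm_num)]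

theorem _root_.TreeLikeVtx.le_inner_radialVec (hv : TreeLikeVtx H 4 r v) (hR : R + 2 ≤ r)
    (hσ : σ ^ 2 = 1) (hw : H.Adj v w) :
    √3 / 2 * ‖radialVec H (σ / √3) (R + 1) v‖ ^ 2 - 1 -
      2 * ‖radialVec H (σ / √3) (R + 1) v‖ ≤
      inner ℝ (radialVec H (σ / √3) (R + 1) v) (σ • radialVec H (σ / √3) (R + 1) w) := by
  have hc := div_sqrt_three_sq hσ
  have hN := hv.norm_sq_radialVec (R := R + 1) (by omega) (by omega) hc
  have hi := hv.inner_radialVec_branchVec (R := R + 1) (by omega) hc hw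
  have he := hv.norm_sq_radialVec_sub_le hR hw hc
  set a := radialVec H (σ / √3) (R + 1) v
  set b := radialVec H (σ / √3) (R + 1) w
  set t := branchVec H (σ / √3) (R + 1) v w
  set e := b - (σ / √3) • (a + (2 : ℝ) • t) with hee
  have hb : b = (σ / √3) • (a + (2 : ℝ) • t) + e := by rw [hee]; abel
  have h1 : inner ℝ a (σ • b) = (‖a‖ ^ 2 + 2 * inner ℝ a t) / √3 + inner ℝ a (σ • e) := by
    have : σ * (σ / √3) = 1 / √3 := by rw [← mul_div_assoc, ← sq, hσ]
    rw [hb, smul_add, inner_add_right, smul_smul, this, real_inner_smul_right, inner_add_right,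
      real_inner_smul_right, real_inner_self_eq_norm_sq]
    ring
  have h2 : -(‖a‖ * 2) ≤ inner ℝ a (σ • e) := by
    have h3 := abs_real_inner_le_norm a (σ • e)
    have h4 : ‖σ • e‖ ≤ 2 := by
      have hs : |σ| = 1 := by
        rcases sq_eq_one_iff.1 hσ with h | h <;> simp [h]
      rw [norm_smul, Real.norm_eq_abs, hs, one_mul]
      nlinarith [norm_nonneg e]
    nlinarith [norm_nonneg a, (abs_le.1 h3).1]
  have h5 : (‖a‖ ^ 2 + 2 * inner ℝ a t) / √3 = √3 / 2 * ‖a‖ ^ 2 - √3 / 6 := by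
    have h6 : √3 ^ 2 = 3 := sq_sqrt (by norm_num)
    rw [div_eq_iff (by positivity), hi]
    push_cast at hN ⊢
    nlinarith
  have h7 : √3 ≤ 2 := by
    rw [sqrt_le_left (by norm_num)]; norm_num
  linarith

/-- Across an edge with tree-like endpoints, the signs of the wave disagree with probability
little more than `1 / 6`. -/
theorem exists_integral_spin_mul_spin_le {ε : ℝ} (hε : 0 < ε) (hσ : σ ^ 2 = 1) :
    ∃ R₀ : ℕ, ∀ R ≥ R₀, ∀ {W : Type} [Fintype W] {H : SimpleGraph W} {r : ℕ} {v w : W},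
      TreeLikeVtx H 4 r v → TreeLikeVtx H 4 r w → R + 2 ≤ r → H.Adj v w →
      ∫ z, (1 - σ * (spin (inner ℝ (radialVec H (σ / √3) (R + 1) v) z) *
        spin (inner ℝ (radialVec H (σ / √3) (R + 1) w) z))) / 2
        ∂stdGaussian (EuclideanSpace ℝ W) ≤ 1 / 6 + ε := by
  obtain ⟨ρ, hρ, hρ0, key⟩ := exists_stdGaussian_real_pos_nonpos_le (half_pos hε)
  set η := √3 / 2 - ρ with hη
  have hη0 : 0 < η := sub_pos.2 hρ
  obtain ⟨R₀, hR₀⟩ := exists_nat_gt ((3 / η) ^ 2)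
  refine ⟨R₀, fun R hR W _ H r v w hv hw hr hvw => ?_⟩
  have hc := div_sqrt_three_sq hσ
  have hN := hv.norm_sq_radialVec (R := R + 1) (by omega) (by omega) hc
  have hNw := hw.norm_sq_radialVec (R := R + 1) (by omega) (by omega) hc
  have hle := hv.le_inner_radialVec hr hσ hvw
  have ha0 : radialVec H (σ / √3) (R + 1) v ≠ 0 := radialVec_ne_zero
  have hb0 : radialVec H (σ / √3) (R + 1) w ≠ 0 := radialVec_ne_zero
  set a := radialVec H (σ / √3) (R + 1) v
  set b := radialVec H (σ / √3) (R + 1) w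
  have hs : |σ| = 1 := by
    rcases sq_eq_one_iff.1 hσ with h | h <;> simp [h]
  have hab : ‖a‖ = ‖σ • b‖ := by
    rw [norm_smul, Real.norm_eq_abs, hs, one_mul]
    exact (sq_eq_sq₀ (norm_nonneg _) (norm_nonneg _)).1 (hN.trans hNw.symm)
  have hρN : ρ * ‖a‖ ^ 2 ≤ inner ℝ a (σ • b) := by
    refine le_trans ?_ hle
    have h1 : (R₀ : ℝ) ≤ R := by exact_mod_cast hR
    have h2 : (3 / η) ^ 2 ≤ ‖a‖ ^ 2 := by
      rw [hN]
      push_cast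
      have : (0 : ℝ) ≤ R := by positivity
      linarith
    have h3 : 3 / η ≤ ‖a‖ := (sq_le_sq₀ (by positivity) (norm_nonneg _)).1 h2
    rw [div_le_iff₀ hη0] at h3
    have h4 : 1 ≤ ‖a‖ := by
      have : (1 : ℝ) ≤ ‖a‖ ^ 2 := by
        rw [hN]
        have : (0 : ℝ) ≤ ((R + 1 : ℕ) : ℝ) := by positivity
        linarith
      exact (one_le_sq_iff₀ (norm_nonneg _)).1 this
    nlinarith
  have k1 := key ha0 hab hρN
  have k2 := key (a := σ • b) (b := a) (norm_pos_iff.1 (by rw [← hab]; exact norm_pos_iff.2 ha0))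
    hab.symm (by rw [← hab, real_inner_comm]; exact hρN)
  set A := {z | 0 < inner ℝ a z ∧ inner ℝ (σ • b) z ≤ 0} with hA
  set B := {z | 0 < inner ℝ (σ • b) z ∧ inner ℝ a z ≤ 0} with hB
  have mA : MeasurableSet A := by
    rw [hA, Set.ofPred_and]
    exact (measurableSet_lt measurable_const (by fun_prop)).inter
      (measurableSet_le (by fun_prop) measurable_const)
  have mB : MeasurableSet B := by
    rw [hB, Set.ofPred_and]
    exact (measurableSet_lt measurable_const (by fun_prop)).inter
      (measurableSet_le (by fun_prop) measurable_const)
  have iA : Integrable (A.indicator fun _ => (1 : ℝ)) (stdGaussian (EuclideanSpace ℝ W)) :=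
    (integrable_const 1).indicator mA
  have iB : Integrable (B.indicator fun _ => (1 : ℝ)) (stdGaussian (EuclideanSpace ℝ W)) :=
    (integrable_const 1).indicator mB
  have hle : ∀ᵐ z ∂stdGaussian (EuclideanSpace ℝ W),
      (1 - σ * (spin (inner ℝ a z) * spin (inner ℝ b z))) / 2 ≤
        A.indicator (fun _ => (1 : ℝ)) z + B.indicator (fun _ => (1 : ℝ)) z := by
    filter_upwards [ae_inner_ne_zero hb0] with z hz
    have e : σ * (spin (inner ℝ a z) * spin (inner ℝ b z)) =
        spin (inner ℝ a z) * spin (inner ℝ (σ • b) z) := by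
      rw [real_inner_smul_left, spin_mul_of_sq_eq_one hσ hz]
      ring
    rw [e]
    have nA : 0 ≤ A.indicator (fun _ => (1 : ℝ)) z := Set.indicator_nonneg (by simp) _
    have nB : 0 ≤ B.indicator (fun _ => (1 : ℝ)) z := Set.indicator_nonneg (by simp) _
    rcases le_or_gt (inner ℝ a z) 0 with h1 | h1 <;>
      rcases le_or_gt (inner ℝ (σ • b) z) 0 with h2 | h2
    · rw [spin_of_nonpos h1, spin_of_nonpos h2]
      linarith
    · rw [spin_of_nonpos h1, spin_of_pos h2]
      rw [Set.indicator_of_mem (show z ∈ B from ⟨h2, h1⟩)]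
      linarith
    · rw [spin_of_pos h1, spin_of_nonpos h2]
      rw [Set.indicator_of_mem (show z ∈ A from ⟨h1, h2⟩)]
      linarith
    · rw [spin_of_pos h1, spin_of_pos h2]
      linarith
  refine (integral_mono_ae ?_ (iA.add iB) hle).trans ?_
  · refine Integrable.of_bound (C := 1) ?_ (ae_of_all _ fun z => ?_)
    · exact (((((measurable_spin.comp (by fun_prop)).mul
        (measurable_spin.comp (by fun_prop))).const_mul σ).const_sub 1).div_const
          2).aestronglyMeasurable
    · have : |σ * (spin (inner ℝ a z) * spin (inner ℝ b z))| = 1 := by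
        rw [abs_mul, abs_mul, hs, abs_spin, abs_spin]
        norm_num
      have := abs_le.1 this.le
      rw [Real.norm_eq_abs, abs_le]
      constructor <;> linarith
  · simp only [Pi.add_apply]
    rw [integral_add iA iB, integral_indicator_const _ mA, integral_indicator_const _ mB]
    simp only [smul_eq_mul, mul_one]
    linarith

end SimpleGraph

namespace SimpleGraph

open MeasureTheory ProbabilityTheory

variable {σ : ℝ}

theorem mul_spin_eq_neg_one {k x t e : ℝ} (hσ : σ ^ 2 = 1) (hk : 20 ≤ k) (hx : x ≤ 1 + k / 2)
    (ht : t ≤ -k) (he : |e| < k / 2) : σ * spin (σ / √3 * (x + 2 * t) + e) = -1 := by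
  set y := σ / √3 * (x + 2 * t) + e with hy
  have h30 : 0 < √3 := by positivity
  have h9 : √3 < 9 / 5 := by
    rw [sqrt_lt' (by norm_num)]; norm_num
  have h4 : √3 * (σ * y) = (x + 2 * t) + √3 * (σ * e) := by
    have : √3 * (σ * (σ / √3)) = 1 := by
      rw [mul_div_assoc', ← sq, hσ]
      field_simp
    rw [hy]
    linear_combination (x + 2 * t) * this
  have h5 : σ * e ≤ k / 2 := by
    have := abs_lt.1 he
    rcases sq_eq_one_iff.1 hσ with rfl | rfl <;> linarith
  have h6 : σ * y < 0 := by
    by_contra! h7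
    nlinarith [mul_nonneg h30.le h7]
  have h8 : y ≠ 0 := fun h0 => by simp [h0] at h6
  rw [← spin_mul_of_sq_eq_one hσ h8, spin_of_nonpos h6.le]

set_option maxHeartbeats 400000 in
/-- The spin at a tree-like vertex disagrees with at least three of its four neighbours with a
probability bounded below. -/
theorem exists_le_stdGaussian_real_sum_spin_le (hσ : σ ^ 2 = 1) :
    ∃ p > 0, ∃ R₀ : ℕ, ∀ R ≥ R₀, ∀ {W : Type} [Fintype W] {H : SimpleGraph W} {r : ℕ} {v : W}
      {s : Finset W}, TreeLikeVtx H 4 r v → R + 2 ≤ r → (∀ w, w ∈ s ↔ H.Adj v w) →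
      p ≤ (stdGaussian (EuclideanSpace ℝ W)).real {z |
        ∑ w ∈ s, σ * (spin (inner ℝ (radialVec H (σ / √3) (R + 1) v) z) *
          spin (inner ℝ (radialVec H (σ / √3) (R + 1) w) z)) ≤ -2} := by
  classical
  obtain ⟨p, hp, key⟩ := exists_stdGaussian_real_box (ι := Fin 5)
    (l := ![-1, -11 / 10, -11 / 10, -11 / 10, 34 / 10]) (u := ![1, -1, -1, -1, 35 / 10])
    (by intro i; fin_cases i <;> norm_num)
  obtain ⟨R₀, hR₀⟩ := exists_nat_gt (3 * (48 / p + 400))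
  refine ⟨p / 2, half_pos hp, R₀, fun R hR W _ H r v s hv hr hs => ?_⟩
  have hc := div_sqrt_three_sq hσ
  set c := σ / √3 with hcdef
  set X : W → EuclideanSpace ℝ W → ℝ := fun w z => inner ℝ (radialVec H c (R + 1) w) z with hX
  set K : ℝ := (R + 1 : ℕ) / 3 with hK
  have hKlarge : 48 / p + 400 ≤ K := by
    have h1 : (R₀ : ℝ) ≤ R := by exact_mod_cast hR
    rw [hK, le_div_iff₀ (by norm_num)]
    push_cast
    linarith
  have hp48 : 0 < 48 / p := by positivity
  have hK0 : 0 < K := by linarith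
  have hk0 : 0 < √K := sqrt_pos.2 hK0
  have hkk : √K * √K = K := mul_self_sqrt hK0.le
  have hk20 : 20 ≤ √K := by
    rw [le_sqrt' (by norm_num)]
    linarith
  have hcard : s.card = 4 := by
    rw [← hv.card_neighborFinset (Reachable.refl v) (by simp; omega)]
    congr 1
    ext w
    simp [hs]
  let f := (s.equivFinOfCardEq hcard).symm
  set w : Fin 4 → W := fun i => f i with hw
  have hadj : ∀ i, H.Adj v (w i) := fun i => (hs _).1 (f i).2
  have hinj : ∀ i j, i ≠ j → w i ≠ w j := fun i j hij h => hij (f.injective (Subtype.ext h))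
  have hsum : ∀ {M : Type} [AddCommMonoid M] (F : W → M),
      ∑ x ∈ s, F x = F (w 0) + F (w 1) + F (w 2) + F (w 3) := by
    intro M _ F
    rw [← Finset.sum_coe_sort, ← f.sum_comp, Fin.sum_univ_four]
  set t : Fin 4 → EuclideanSpace ℝ W := fun i => branchVec H c (R + 1) v (w i) with ht
  have htn : ∀ i, inner ℝ (t i) (t i) = K := fun i => by
    rw [real_inner_self_eq_norm_sq, hv.norm_sq_branchVec (by omega) (hadj i) hc]
  have hto : ∀ i j, i ≠ j → inner ℝ (t i) (t j) = 0 := fun i j hij =>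
    hv.inner_branchVec (by omega) (hadj i) (hadj j) (hinj i j hij)
  set g : Fin 5 → EuclideanSpace ℝ W :=
    Fin.cons (EuclideanSpace.single v 1) fun i => (√K)⁻¹ • t i with hg
  have hgo : Orthonormal ℝ g := by
    rw [orthonormal_iff_ite]
    intro i j
    refine Fin.cases ?_ (fun i => ?_) i <;> refine Fin.cases ?_ (fun j => ?_) j
    · simp [hg]
    · rw [if_neg (Fin.succ_ne_zero j).symm, hg, Fin.cons_zero, Fin.cons_succ,
        real_inner_smul_right, inner_single_branchVec, mul_zero]
    · rw [if_neg (Fin.succ_ne_zero i), hg, Fin.cons_zero, Fin.cons_succ,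
        real_inner_smul_left, real_inner_comm, inner_single_branchVec, mul_zero]
    · rw [hg, Fin.cons_succ, Fin.cons_succ, real_inner_smul_left, real_inner_smul_right]
      by_cases hij : i = j
      · subst hij
        rw [if_pos rfl, htn]
        field_simp
        linarith
      · rw [if_neg (by simpa using hij), hto i j hij, mul_zero, mul_zero]
  set e : Fin 4 → EuclideanSpace ℝ W := fun i => radialVec H c (R + 1) (w i) -
    c • (radialVec H c (R + 1) v + (2 : ℝ) • t i) with he
  have hen : ∀ i, ‖e i‖ ^ 2 ≤ 2 := fun i => hv.norm_sq_radialVec_sub_le hr (hadj i) hc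
  set box := {z | ∀ i, inner ℝ (g i) z ∈ Set.Ioo
    ((![-1, -11 / 10, -11 / 10, -11 / 10, 34 / 10] : Fin 5 → ℝ) i)
    ((![1, -1, -1, -1, 35 / 10] : Fin 5 → ℝ) i)} with hbox
  set bad : Fin 4 → Set (EuclideanSpace ℝ W) := fun i => {z | √K / 2 ≤ |inner ℝ (e i) z|}
    with hbad
  set S := {z | ∑ x ∈ s, σ * (spin (X v z) * spin (X x z)) ≤ -2} with hS
  have hbadle : ∀ i, (stdGaussian (EuclideanSpace ℝ W)).real (bad i) ≤ p / 6 := by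
    intro i
    refine (stdGaussian_real_le_abs_inner_le (e i) (half_pos hk0)).trans ?_
    rw [div_pow, sq_sqrt hK0.le, div_le_iff₀ (by positivity)]
    have h1 : 48 ≤ K * p := by rw [← div_le_iff₀ hp]; linarith
    nlinarith [hen i]
  have hsub : box ⊆ S ∪ (bad 0 ∪ bad 1 ∪ bad 2) := by
    intro z hz
    by_contra hcon
    simp only [Set.mem_union, not_or, hbad, Set.mem_ofPred_eq, not_le] at hcon
    obtain ⟨hzS, ⟨hb0, hb1⟩, hb2⟩ := hcon
    have g0 := hz 0
    have g1 := hz 1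
    have g2 := hz 2
    have g3 := hz 3
    have g4 := hz 4
    have hgz : ∀ i : Fin 4, inner ℝ (t i) z = √K * inner ℝ (g i.succ) z := by
      intro i
      rw [hg, Fin.cons_succ, real_inner_smul_left, mul_inv_cancel_left₀ hk0.ne']
    have t0 := hgz 0
    have t1 := hgz 1
    have t2 := hgz 2
    have t3 := hgz 3
    simp only [Fin.succ_zero_eq_one, Fin.succ_one_eq_two,
      show (2 : Fin 4).succ = 3 from rfl, show (3 : Fin 4).succ = 4 from rfl] at t0 t1 t2 t3
    have hXv : X v z = inner ℝ (g 0) z + (inner ℝ (t 0) z + inner ℝ (t 1) z + inner ℝ (t 2) z +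
        inner ℝ (t 3) z) := by
      rw [hX]
      beta_reduce
      rw [hv.radialVec_eq (by omega) hs, inner_add_left, hsum]
      simp only [inner_add_left]
      rfl
    set k := √K
    generalize inner ℝ (g 0) z = y0 at *
    generalize inner ℝ (g 1) z = y1 at *
    generalize inner ℝ (g 2) z = y2 at *
    generalize inner ℝ (g 3) z = y3 at *
    generalize inner ℝ (g 4) z = y4 at *
    simp at g0 g1 g2 g3 g4
    have hXv' : X v z = y0 + k * (y1 + y2 + y3 + y4) := by
      rw [hXv, t0, t1, t2, t3]; ring
    have hpos : 0 < X v z := by rw [hXv']; nlinarith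
    have hup : X v z ≤ 1 + k / 2 := by rw [hXv']; nlinarith
    have hneg : ∀ i, inner ℝ (t i) z ≤ -k → |inner ℝ (e i) z| < k / 2 →
        σ * spin (X (w i) z) = -1 := by
      intro i hti hei
      have hXw : X (w i) z = σ / √3 * (X v z + 2 * inner ℝ (t i) z) + inner ℝ (e i) z := by
        simp only [hX, he, inner_sub_left, inner_add_left, real_inner_smul_left]
        ring
      rw [hXw]
      exact mul_spin_eq_neg_one hσ hk20 hup hti hei
    have s0 := hneg 0 (by rw [t0]; nlinarith) hb0
    have s1 := hneg 1 (by rw [t1]; nlinarith) hb1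
    have s2 := hneg 2 (by rw [t2]; nlinarith) hb2
    refine hzS ?_
    rw [hS, Set.mem_ofPred_eq, hsum, spin_of_pos hpos]
    have s3 : σ * spin (X (w 3) z) ≤ 1 := by
      have h1 : |σ * spin (X (w 3) z)| = 1 := by
        rw [abs_mul, abs_spin]
        rcases sq_eq_one_iff.1 hσ with rfl | rfl <;> simp
      exact (le_abs_self _).trans h1.le
    simp only [one_mul]
    linarith
  have h1 := key hgo
  have h2 := measureReal_mono (μ := stdGaussian (EuclideanSpace ℝ W)) hsub
  have h3 := measureReal_union_le (μ := stdGaussian (EuclideanSpace ℝ W)) S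
    (bad 0 ∪ bad 1 ∪ bad 2)
  have h4 := measureReal_union_le (μ := stdGaussian (EuclideanSpace ℝ W)) (bad 0 ∪ bad 1) (bad 2)
  have h5 := measureReal_union_le (μ := stdGaussian (EuclideanSpace ℝ W)) (bad 0) (bad 1)
  rw [h1] at h2
  have := hbadle 0
  have := hbadle 1
  have := hbadle 2
  linarith

end SimpleGraph

namespace SimpleGraph

variable {W : Type*} [Fintype W] {H : SimpleGraph W} [DecidableRel H.Adj] {σ : ℝ} {s : W → ℝ}

/-- The energy of a spin configuration: for spins `±1` this is the number of edges whose
endpoints carry spins with product `-σ`. -/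
noncomputable def spinEnergy (H : SimpleGraph W) [DecidableRel H.Adj] (σ : ℝ) (s : W → ℝ) : ℝ :=
  ∑ v, ∑ w ∈ H.neighborFinset v, (1 - σ * (s v * s w)) / 4

theorem sum_neighborFinset_comm {M : Type*} [AddCommMonoid M] (F : W → W → M) :
    ∑ v, ∑ w ∈ H.neighborFinset v, F v w = ∑ v, ∑ w ∈ H.neighborFinset v, F w v :=
  Finset.sum_comm' fun v w => by simp [adj_comm]

theorem two_mul_ncard_edgeSet : (2 * H.edgeSet.ncard : ℝ) = ∑ v, (H.degree v : ℝ) := by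
  classical
  rw [Set.ncard_eq_toFinset_card']
  have := H.sum_degrees_eq_twice_card_edges
  rw [edgeFinset] at this
  exact_mod_cast this.symm

theorem spinEnergy_add_spinEnergy_neg :
    spinEnergy H σ s + spinEnergy H (-σ) s = H.edgeSet.ncard := by
  have h : ∑ v, ∑ w ∈ H.neighborFinset v, (1 : ℝ) / 2 = H.edgeSet.ncard := by
    simp only [Finset.sum_const, card_neighborFinset_eq_degree, nsmul_eq_mul]
    rw [← Finset.sum_mul, ← two_mul_ncard_edgeSet]
    ring
  rw [← h, spinEnergy, spinEnergy, ← Finset.sum_add_distrib]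
  refine Finset.sum_congr rfl fun v _ => ?_
  rw [← Finset.sum_add_distrib]
  refine Finset.sum_congr rfl fun w _ => ?_
  ring

theorem spinEnergy_neg_spin : spinEnergy H σ (fun v => -s v) = spinEnergy H σ s := by
  simp [spinEnergy]

theorem bisectionSize_eq_spinEnergy (hs : ∀ v, s v = 1 ∨ s v = -1) :
    (bisectionSize H {v | s v = 1} : ℝ) = spinEnergy H 1 s := by
  classical
  have h1 : ∀ v w, (1 - 1 * (s v * s w)) / 4 =
      (if s v = 1 ∧ s w = -1 then 1 / 2 else 0) + if s w = 1 ∧ s v = -1 then (1 : ℝ) / 2 else 0 := by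
    intro v w
    rcases hs v with h | h <;> rcases hs w with h' | h' <;> norm_num [h, h']
  have h2 : {e ∈ H.edgeSet | ∃ u v : W, e = s(u, v) ∧ u ∈ {v | s v = 1} ∧ v ∉ {v | s v = 1}} =
      (fun x : Σ _ : W, W => s(x.1, x.2)) '' (((Finset.univ.sigma fun v => H.neighborFinset v).filter
        fun x => s x.1 = 1 ∧ s x.2 = -1 : Finset (Σ _ : W, W)) : Set (Σ _ : W, W)) := by
    have hne : ∀ v, ¬ s v = 1 ↔ s v = -1 := fun v => by
      rcases hs v with h | h <;> norm_num [h]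
    ext e
    simp only [Set.mem_ofPred_eq, hne, Finset.coe_filter, Finset.mem_sigma, Finset.mem_univ,
      true_and, mem_neighborFinset, Set.mem_image, Sigma.exists]
    constructor
    · rintro ⟨he, u, v, rfl, h3, h4⟩
      exact ⟨u, v, ⟨he, h3, h4⟩, rfl⟩
    · rintro ⟨u, v, ⟨h5, h3, h4⟩, rfl⟩
      exact ⟨h5, u, v, rfl, h3, h4⟩
  rw [bisectionSize, h2, Set.InjOn.ncard_image, Set.ncard_coe_finset, spinEnergy]
  · simp_rw [h1, Finset.sum_add_distrib]
    rw [← sum_neighborFinset_comm fun v w => if s v = 1 ∧ s w = -1 then (1 : ℝ) / 2 else 0,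
      Finset.sum_sigma', ← Finset.sum_filter, Finset.sum_const, nsmul_eq_mul]
    ring
  · rintro ⟨u, v⟩ h ⟨u', v'⟩ h' he
    simp only [Finset.coe_filter, Set.mem_ofPred_eq] at h h'
    rcases Sym2.eq_iff.1 he with ⟨rfl, rfl⟩ | ⟨rfl, rfl⟩
    · rfl
    · have := h.2.1.symm.trans h'.2.2
      norm_num at this

theorem isBisection_of_abs_sum_le_one (hs : ∀ v, s v = 1 ∨ s v = -1) (h : |∑ v, s v| ≤ 1) :
    IsBisection {v | s v = 1} := by
  classical
  have h1 : ∑ v, s v = ({v | s v = 1} : Set W).ncard - ({v | s v = 1}ᶜ : Set W).ncard := by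
    rw [Set.ncard_eq_toFinset_card', Set.ncard_eq_toFinset_card', Set.toFinset_compl,
      ← Finset.sum_add_sum_compl ({v | s v = 1} : Set W).toFinset]
    rw [Finset.sum_congr rfl (g := fun _ => (1 : ℝ)) (by simp),
      Finset.sum_congr (s₁ := ({v | s v = 1} : Set W).toFinsetᶜ) rfl (g := fun _ => (-1 : ℝ))]
    · simp [sub_eq_add_neg]
    · intro v hv
      exact (hs v).resolve_left (by simpa using hv)
  rw [h1, abs_le] at h
  constructor
  · have := h.2
    rw [sub_le_iff_le_add'] at this
    exact_mod_cast this
  · have := h.1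
    have : (({v | s v = 1}ᶜ : Set W).ncard : ℝ) ≤ ({v | s v = 1} : Set W).ncard + 1 := by linarith
    exact_mod_cast this

theorem exists_isIndepSet_card_le {A : Finset W} {d : ℕ} (hA : ∀ v ∈ A, H.degree v ≤ d) :
    ∃ I ⊆ A, H.IsIndepSet I ∧ A.card ≤ (d + 1) * I.card := by
  classical
  obtain ⟨I, hI, hmax⟩ := Finset.exists_max_image
    (A.powerset.filter fun I : Finset W => H.IsIndepSet (I : Set W)) Finset.card
    ⟨∅, by simp [IsIndepSet]⟩
  simp only [Finset.mem_filter, Finset.mem_powerset] at hI hmax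
  refine ⟨I, hI.1, hI.2, ?_⟩
  have hsub : A ⊆ I.biUnion fun v => insert v (H.neighborFinset v) := by
    intro u hu
    by_contra hcon
    simp only [Finset.mem_biUnion, Finset.mem_insert, mem_neighborFinset, not_exists, not_and,
      not_or] at hcon
    have huI : u ∉ I := fun h => (hcon u h).1 rfl
    have h1 := hmax (insert u I) ⟨Finset.insert_subset hu hI.1, by
      rw [Finset.coe_insert, IsIndepSet, Set.pairwise_insert]
      exact ⟨hI.2, fun v hv _ => ⟨fun h => (hcon v hv).2 h.symm, (hcon v hv).2⟩⟩⟩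
    rw [Finset.card_insert_of_notMem huI] at h1
    omega
  refine (Finset.card_le_card hsub).trans ?_
  rw [mul_comm]
  refine Finset.card_biUnion_le_card_mul _ _ _ fun v hv => (Finset.card_insert_le _ _).trans ?_
  rw [card_neighborFinset_eq_degree]
  exact Nat.succ_le_succ (hA v (hI.1 hv))

/-- Reverse the spins in `J`. -/
noncomputable def flipSpin [DecidableEq W] (J : Finset W) (s : W → ℝ) (v : W) : ℝ :=
  if v ∈ J then -s v else s v

theorem flipSpin_eq_or {W : Type*} [DecidableEq W] {J : Finset W} {s : W → ℝ}
    (hs : ∀ v, s v = 1 ∨ s v = -1) (v : W) :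
    flipSpin J s v = 1 ∨ flipSpin J s v = -1 := by
  unfold flipSpin
  rcases hs v with h | h <;> split_ifs <;> simp [h]

theorem spinEnergy_flipSpin_le_sub [DecidableEq W] {J : Finset W} (hJ : H.IsIndepSet J)
    (h : ∀ v ∈ J, ∑ w ∈ H.neighborFinset v, σ * (s v * s w) ≤ -2) :
    spinEnergy H σ (flipSpin J s) ≤ spinEnergy H σ s - 2 * J.card := by
  have h1 : spinEnergy H σ (flipSpin J s) = spinEnergy H σ s +
      ∑ v, ∑ w ∈ H.neighborFinset v, ((if v ∈ J then σ * (s v * s w) / 2 else 0) +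
        if w ∈ J then σ * (s w * s v) / 2 else 0) := by
    rw [spinEnergy, spinEnergy, ← Finset.sum_add_distrib]
    refine Finset.sum_congr rfl fun v _ => ?_
    rw [← Finset.sum_add_distrib]
    refine Finset.sum_congr rfl fun w hw => ?_
    rw [mem_neighborFinset] at hw
    unfold flipSpin
    by_cases hv : v ∈ J <;> by_cases hw' : w ∈ J
    · exact absurd hw (hJ hv hw' hw.ne)
    all_goals simp only [hv, hw', if_true, if_false]; ring
  simp only [Finset.sum_add_distrib] at h1
  rw [← sum_neighborFinset_comm fun v w => if v ∈ J then σ * (s v * s w) / 2 else 0] at h1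
  have h2 : ∑ v, ∑ w ∈ H.neighborFinset v, (if v ∈ J then σ * (s v * s w) / 2 else 0) ≤
      ∑ v, if v ∈ J then (-1 : ℝ) else 0 := by
    refine Finset.sum_le_sum fun v _ => ?_
    split_ifs with hv
    · rw [← Finset.sum_div]
      linarith [h v hv]
    · simp
  rw [← Finset.sum_filter, Finset.filter_mem_eq_inter, Finset.univ_inter, Finset.sum_const,
    nsmul_eq_mul] at h2
  linarith

theorem spinEnergy_flipSpin_le_add [DecidableEq W] {J : Finset W} {d : ℕ} (hσ : σ ^ 2 = 1)
    (hs : ∀ v, s v = 1 ∨ s v = -1) (h : ∀ v ∈ J, H.degree v ≤ d) :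
    spinEnergy H σ (flipSpin J s) ≤ spinEnergy H σ s + d * J.card := by
  have h1 : spinEnergy H σ (flipSpin J s) ≤ spinEnergy H σ s +
      ∑ v, ∑ w ∈ H.neighborFinset v, ((if v ∈ J then 1 / 2 else 0) +
        if w ∈ J then (1 : ℝ) / 2 else 0) := by
    rw [spinEnergy, spinEnergy, ← Finset.sum_add_distrib]
    refine Finset.sum_le_sum fun v _ => ?_
    rw [← Finset.sum_add_distrib]
    refine Finset.sum_le_sum fun w _ => ?_
    unfold flipSpin
    rcases sq_eq_one_iff.1 hσ with rfl | rfl <;> rcases hs v with e | e <;>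
      rcases hs w with e' | e' <;> rw [e, e'] <;> split_ifs <;> norm_num
  simp only [Finset.sum_add_distrib] at h1
  rw [← sum_neighborFinset_comm fun v _ => if v ∈ J then (1 : ℝ) / 2 else 0] at h1
  have h2 : ∑ v, ∑ w ∈ H.neighborFinset v, (if v ∈ J then (1 : ℝ) / 2 else 0) ≤
      ∑ v, if v ∈ J then (d : ℝ) / 2 else 0 := by
    refine Finset.sum_le_sum fun v _ => ?_
    split_ifs with hv
    · have : (H.degree v : ℝ) ≤ d := by exact_mod_cast h v hv
      simp only [Finset.sum_const, card_neighborFinset_eq_degree, nsmul_eq_mul]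
      linarith
    · simp
  rw [← Finset.sum_filter, Finset.filter_mem_eq_inter, Finset.univ_inter, Finset.sum_const,
    nsmul_eq_mul] at h2
  linarith

theorem sum_flipSpin [DecidableEq W] {J : Finset W} :
    ∑ v, flipSpin J s v = ∑ v, s v - 2 * ∑ v ∈ J, s v := by
  have h : ∀ v, flipSpin J s v = s v - if v ∈ J then 2 * s v else 0 := by
    intro v
    unfold flipSpin
    split_ifs <;> ring
  simp_rw [h, Finset.sum_sub_distrib]
  rw [← Finset.sum_filter, Finset.filter_mem_eq_inter, Finset.univ_inter, Finset.mul_sum]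

/-- A spin configuration can be balanced at a bounded energy cost per unit of imbalance. -/
theorem exists_abs_sum_le_one_spinEnergy_le {A : Finset W} {d : ℕ} (hσ : σ ^ 2 = 1)
    (hs : ∀ v, s v = 1 ∨ s v = -1) (hA : ∀ v ∈ A, H.degree v ≤ d)
    (hcard : Fintype.card W ≤ 2 * A.card) :
    ∃ s' : W → ℝ, (∀ v, s' v = 1 ∨ s' v = -1) ∧ |∑ v, s' v| ≤ 1 ∧
      spinEnergy H σ s' ≤ spinEnergy H σ s + d * |∑ v, s v| := by
  classical
  wlog hpos : 0 ≤ ∑ v, s v generalizing s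
  · obtain ⟨s', h1, h2, h3⟩ := this (s := fun v => -s v)
      (fun v => by rcases hs v with h | h <;> simp [h])
      (by rw [Finset.sum_neg_distrib]; linarith)
    refine ⟨s', h1, h2, ?_⟩
    rwa [spinEnergy_neg_spin, Finset.sum_neg_distrib, abs_neg] at h3
  set P : Finset W := {v | s v = 1} with hP
  have hsum : ∑ v, s v = 2 * P.card - Fintype.card W := by
    have h1 : ∀ v, s v = (if v ∈ P then 2 else 0) - 1 := by
      intro v
      rcases hs v with h | h <;> norm_num [hP, h]
    rw [Finset.sum_congr rfl fun v _ => h1 v, Finset.sum_sub_distrib, ← Finset.sum_filter,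
      Finset.filter_mem_eq_inter, Finset.univ_inter]
    simp [mul_comm]
  have hP2 : Fintype.card W ≤ 2 * P.card := by
    rw [hsum, sub_nonneg] at hpos
    exact_mod_cast hpos
  obtain ⟨m, hm⟩ : ∃ m, m = (2 * P.card - Fintype.card W) / 2 := ⟨_, rfl⟩
  have hPA : m ≤ (P ∩ A).card := by
    have h1 := Finset.card_union_add_card_inter P A
    have h2 := Finset.card_le_univ (P ∪ A)
    omega
  obtain ⟨J, hJ, hJc⟩ := Finset.exists_subset_card_eq hPA
  have hJs : ∑ v ∈ J, s v = m := by
    rw [Finset.sum_congr rfl (g := fun _ => (1 : ℝ)), ← hJc]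
    · simp
    · intro v hv
      simpa [hP] using (Finset.mem_inter.1 (hJ hv)).1
  have hm1 : 2 * m + Fintype.card W ≤ 2 * P.card := by omega
  have hm2 : 2 * P.card ≤ 2 * m + Fintype.card W + 1 := by omega
  have hm1' : (2 * m + Fintype.card W : ℝ) ≤ 2 * P.card := by exact_mod_cast hm1
  have hm2' : (2 * P.card : ℝ) ≤ 2 * m + Fintype.card W + 1 := by exact_mod_cast hm2
  refine ⟨flipSpin J s, flipSpin_eq_or hs, ?_, ?_⟩
  · rw [sum_flipSpin, hJs, hsum, abs_le]
    constructor <;> linarith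
  · refine (spinEnergy_flipSpin_le_add hσ hs fun v hv =>
      hA v (Finset.mem_inter.1 (hJ hv)).2).trans ?_
    have h0 : (0 : ℝ) ≤ m := by positivity
    rw [abs_of_nonneg hpos, hsum, hJc]
    gcongr
    linarith

end SimpleGraph

namespace SimpleGraph

open MeasureTheory ProbabilityTheory

variable {W : Type} [Fintype W] {H : SimpleGraph W} {σ c : ℝ} {R : ℕ} {v w : W}

theorem inner_radialVec_congr {z z' : EuclideanSpace ℝ W}
    (h : ∀ x ∈ H.closedBallFinset v R, z x = z' x) :
    inner ℝ (radialVec H c R v) z = inner ℝ (radialVec H c R v) z' := by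
  rw [PiLp.inner_apply, PiLp.inner_apply]
  refine Finset.sum_congr rfl fun x _ => ?_
  by_cases hx : x ∈ H.closedBallFinset v R
  · rw [h x hx]
  · rw [radialVec_apply_eq_zero hx, inner_zero_left, inner_zero_left]

/-- The signs of the Gaussian wave on `H`. -/
noncomputable def waveSpin (H : SimpleGraph W) (c : ℝ) (R : ℕ) (z : EuclideanSpace ℝ W) (v : W) :
    ℝ :=
  spin (inner ℝ (radialVec H c R v) z)

theorem waveSpin_eq_or (z : EuclideanSpace ℝ W) (v : W) :
    waveSpin H c R z v = 1 ∨ waveSpin H c R z v = -1 :=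
  sq_eq_one_iff.1 (spin_sq _)

@[fun_prop]
theorem measurable_waveSpin (v : W) : Measurable fun z => waveSpin H c R z v :=
  measurable_spin.comp (by fun_prop)

theorem ae_waveSpin_neg :
    ∀ᵐ z ∂stdGaussian (EuclideanSpace ℝ W), ∀ v, waveSpin H c R (-z) v = -waveSpin H c R z v := by
  filter_upwards [ae_all_iff.2 fun v => ae_inner_ne_zero (a := radialVec H c R v)
    radialVec_ne_zero] with z hz v
  rw [waveSpin, inner_neg_right, spin_neg (hz v), waveSpin]

open Classical in
/-- The vertices of `I` whose spin disagrees with at least three of four neighbours. -/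
noncomputable def frustrated (H : SimpleGraph W) [DecidableRel H.Adj] (σ : ℝ) (I : Finset W)
    (s : W → ℝ) : Finset W :=
  {v ∈ I | ∑ w ∈ H.neighborFinset v, σ * (s v * s w) ≤ -2}

open Classical in
/-- The signs of the Gaussian wave on `H`, reversed at the frustrated vertices of `I`. -/
noncomputable def improvedSpin (H : SimpleGraph W) [DecidableRel H.Adj] (σ c : ℝ) (R : ℕ)
    (I : Finset W) (z : EuclideanSpace ℝ W) : W → ℝ :=
  flipSpin (frustrated H σ I (waveSpin H c R z)) (waveSpin H c R z)

section

variable [DecidableRel H.Adj] {I : Finset W}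

theorem measurableSet_frustrated (v : W) :
    MeasurableSet {z | v ∈ frustrated H σ I (waveSpin H c R z)} := by
  simp only [frustrated, Finset.mem_filter]
  rw [Set.ofPred_and]
  exact (MeasurableSet.const _).inter (measurableSet_le (by fun_prop) measurable_const)

theorem measurable_improvedSpin (v : W) : Measurable fun z => improvedSpin H σ c R I z v :=
  Measurable.ite (measurableSet_frustrated v) (by fun_prop) (by fun_prop)

theorem improvedSpin_eq_or (z : EuclideanSpace ℝ W) (v : W) :
    improvedSpin H σ c R I z v = 1 ∨ improvedSpin H σ c R I z v = -1 := by
  classical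
  exact flipSpin_eq_or (waveSpin_eq_or z) v

theorem improvedSpin_congr {z z' : EuclideanSpace ℝ W}
    (h : ∀ x ∈ H.closedBallFinset v (R + 1), z x = z' x) :
    improvedSpin H σ c R I z v = improvedSpin H σ c R I z' v := by
  have h1 : waveSpin H c R z v = waveSpin H c R z' v := by
    rw [waveSpin, inner_radialVec_congr fun x hx => h x (closedBallFinset_mono (by omega) hx)]
    rfl
  have h2 : ∀ w ∈ H.neighborFinset v, waveSpin H c R z w = waveSpin H c R z' w := by
    intro w hw
    rw [mem_neighborFinset] at hw
    rw [waveSpin, inner_radialVec_congr fun x hx => h x (by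
      rw [add_comm]; exact mem_closedBallFinset_trans hw.mem_closedBallFinset hx)]
    rfl
  have h3 : v ∈ frustrated H σ I (waveSpin H c R z) ↔
      v ∈ frustrated H σ I (waveSpin H c R z') := by
    rw [frustrated, frustrated, Finset.mem_filter, Finset.mem_filter, h1,
      Finset.sum_congr rfl fun w hw => by rw [h2 w hw]]
  by_cases h4 : v ∈ frustrated H σ I (waveSpin H c R z')
  · simp [improvedSpin, flipSpin, h4, h3.2 h4, h1]
  · simp [improvedSpin, flipSpin, h4, mt h3.1 h4, h1]

theorem ae_improvedSpin_neg (v : W) : ∀ᵐ z ∂stdGaussian (EuclideanSpace ℝ W),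
    improvedSpin H σ c R I (-z) v = -improvedSpin H σ c R I z v := by
  filter_upwards [ae_waveSpin_neg (H := H) (c := c) (R := R)] with z hz
  have h1 : v ∈ frustrated H σ I (waveSpin H c R (-z)) ↔
      v ∈ frustrated H σ I (waveSpin H c R z) := by
    simp only [frustrated, Finset.mem_filter, hz, neg_mul_neg]
  by_cases h2 : v ∈ frustrated H σ I (waveSpin H c R z)
  · simp [improvedSpin, flipSpin, h2, h1.2 h2, hz]
  · simp [improvedSpin, flipSpin, h2, mt h1.1 h2, hz]

end

theorem _root_.TreeLikeVtx.degree_eq [DecidableRel H.Adj] {r : ℕ} (hv : TreeLikeVtx H 4 r v)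
    (hr : 1 ≤ r) : H.degree v = 4 := by
  rw [← card_neighborFinset_eq_degree,
    ← hv.card_neighborFinset (Reachable.refl v) (by simpa using hr)]
  congr 1
  ext w
  simp

theorem integral_waveSpin_edge_le [DecidableRel H.Adj] {A : Finset W} {q : ℝ} {r : ℕ}
    (hσ : σ ^ 2 = 1) (hq : 0 ≤ q) (hr : 1 ≤ r) (hA : ∀ v ∈ A, TreeLikeVtx H 4 r v)
    (hedge : ∀ v ∈ A, ∀ w ∈ A, H.Adj v w →
      ∫ z, (1 - σ * (waveSpin H c R z v * waveSpin H c R z w)) / 2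
        ∂stdGaussian (EuclideanSpace ℝ W) ≤ q) :
    Integrable (fun z => spinEnergy H σ (waveSpin H c R z)) (stdGaussian (EuclideanSpace ℝ W)) ∧
    ∫ z, spinEnergy H σ (waveSpin H c R z) ∂stdGaussian (EuclideanSpace ℝ W) ≤
      q * H.edgeSet.ncard + (2 * H.edgeSet.ncard - 4 * A.card) := by
  classical
  have hb : ∀ v w z, ‖(1 - σ * (waveSpin H c R z v * waveSpin H c R z w)) / 4‖ ≤ 1 / 2 := by
    intro v w z
    rcases sq_eq_one_iff.1 hσ with rfl | rfl <;>
      rcases waveSpin_eq_or (H := H) (c := c) (R := R) z v with h | h <;>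
      rcases waveSpin_eq_or (H := H) (c := c) (R := R) z w with h' | h' <;>
      rw [h, h'] <;> norm_num
  have hInt : ∀ v w, Integrable
      (fun z => (1 - σ * (waveSpin H c R z v * waveSpin H c R z w)) / 4)
      (stdGaussian (EuclideanSpace ℝ W)) := fun v w =>
    .of_bound (Measurable.aestronglyMeasurable (by fun_prop)) (1 / 2) (ae_of_all _ (hb v w))
  have hInt' : ∀ v, Integrable (fun z => ∑ w ∈ H.neighborFinset v,
      (1 - σ * (waveSpin H c R z v * waveSpin H c R z w)) / 4)
      (stdGaussian (EuclideanSpace ℝ W)) := fun v =>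
    integrable_finsetSum _ fun w _ => hInt v w
  refine ⟨integrable_finsetSum _ fun v _ => hInt' v, ?_⟩
  have h1 : ∀ v, ∀ w ∈ H.neighborFinset v,
      ∫ z, (1 - σ * (waveSpin H c R z v * waveSpin H c R z w)) / 4
        ∂stdGaussian (EuclideanSpace ℝ W) ≤
      q / 2 + ((if v ∉ A then 1 / 2 else 0) + if w ∉ A then 1 / 2 else 0) := by
    intro v w hvw
    have h2 : ∫ z, (1 - σ * (waveSpin H c R z v * waveSpin H c R z w)) / 4
        ∂stdGaussian (EuclideanSpace ℝ W) ≤ 1 / 2 := by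
      refine (le_abs_self _).trans ((norm_integral_le_of_norm_le_const
        (ae_of_all _ (hb v w))).trans ?_)
      simp
    by_cases hv : v ∈ A
    · by_cases hw : w ∈ A
      · have h3 := hedge v hv w hw (by simpa using hvw)
        rw [integral_div] at h3 ⊢
        simp only [hv, hw, not_true, if_false]
        linarith
      · simp only [hv, hw, not_true, not_false_eq_true, if_true, if_false]
        linarith
    · simp only [hv, not_false_eq_true, if_true]
      split_ifs <;> linarith
  unfold spinEnergy
  rw [integral_finsetSum _ fun v _ => hInt' v]
  simp_rw [integral_finsetSum _ fun w _ => hInt _ w]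
  refine (Finset.sum_le_sum fun v _ => Finset.sum_le_sum (h1 v)).trans ?_
  simp only [Finset.sum_add_distrib]
  rw [← sum_neighborFinset_comm fun v _ => if v ∉ A then (1 : ℝ) / 2 else 0]
  simp only [Finset.sum_const, card_neighborFinset_eq_degree, nsmul_eq_mul]
  rw [← Finset.sum_mul, ← two_mul_ncard_edgeSet]
  have h3 : ∑ v, (H.degree v : ℝ) * (if v ∉ A then 1 / 2 else 0) =
      H.edgeSet.ncard - 2 * A.card := by
    have h4 : ∀ v, (H.degree v : ℝ) * (if v ∉ A then 1 / 2 else 0) =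
        H.degree v / 2 - if v ∈ A then 2 else 0 := by
      intro v
      by_cases hv : v ∈ A
      · simp [hv, (hA v hv).degree_eq hr]
        norm_num
      · simp [hv]
        ring
    rw [Finset.sum_congr rfl fun v _ => h4 v, Finset.sum_sub_distrib, ← Finset.sum_div,
      ← two_mul_ncard_edgeSet, ← Finset.sum_filter, Finset.filter_mem_eq_inter,
      Finset.univ_inter, Finset.sum_const, nsmul_eq_mul]
    ring
  rw [h3]
  apply le_of_eq
  ring

/-- If edges between tree-like vertices have expected energy at most `q` and tree-like vertices
are frustrated with probability at least `p`, then there is a balanced configuration of low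
energy. -/
theorem exists_balanced_spinEnergy_le [DecidableRel H.Adj] {A : Finset W} {p q t : ℝ} {r : ℕ}
    (hσ : σ ^ 2 = 1) (hq : 0 ≤ q) (hp : 0 ≤ p) (ht : 0 < t) (hr : 2 * R + 2 ≤ r)
    (hA : ∀ v ∈ A, TreeLikeVtx H 4 r v) (hcard : Fintype.card W ≤ 2 * A.card)
    (hedge : ∀ v ∈ A, ∀ w ∈ A, H.Adj v w →
      ∫ z, (1 - σ * (waveSpin H c R z v * waveSpin H c R z w)) / 2
        ∂stdGaussian (EuclideanSpace ℝ W) ≤ q)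
    (hflip : ∀ v ∈ A, p ≤ (stdGaussian (EuclideanSpace ℝ W)).real {z |
      ∑ w ∈ H.neighborFinset v, σ * (waveSpin H c R z v * waveSpin H c R z w) ≤ -2}) :
    ∃ s : W → ℝ, (∀ v, s v = 1 ∨ s v = -1) ∧ |∑ v, s v| ≤ 1 ∧
      spinEnergy H σ s ≤ q * H.edgeSet.ncard + (2 * H.edgeSet.ncard - 4 * A.card) -
        2 / 5 * p * A.card + 4 * (Fintype.card W * 5 ^ (2 * R + 2) / t + t +
          (Fintype.card W - A.card)) := by
  classical
  have hdeg : ∀ v ∈ A, H.degree v ≤ 4 := fun v hv => ((hA v hv).degree_eq (by omega)).le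
  obtain ⟨I, hIA, hI, hIcard⟩ := exists_isIndepSet_card_le hdeg
  obtain ⟨hE, hEle⟩ := integral_waveSpin_edge_le hσ hq (by omega) hA hedge
  set μ := stdGaussian (EuclideanSpace ℝ W)
  set Y : EuclideanSpace ℝ W → ℝ := fun z => ∑ v ∈ A, improvedSpin H σ c R I z v with hY
  set F : EuclideanSpace ℝ W → ℝ := fun z => (frustrated H σ I (waveSpin H c R z)).card with hF
  have habs : ∀ v z, |improvedSpin H σ c R I z v| = 1 := fun v z => by
    rcases improvedSpin_eq_or (H := H) (σ := σ) (c := c) (R := R) (I := I) z v with h | h <;>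
      simp [h]
  have hYm : Measurable Y := Finset.measurable_sum _ fun v _ => measurable_improvedSpin v
  have hYb : ∀ z, |Y z| ≤ A.card := fun z => by
    refine (Finset.abs_sum_le_sum_abs _ _).trans ?_
    simp [habs]
  have hYi : Integrable (fun z => Y z ^ 2) μ := by
    refine .of_bound (hYm.pow_const 2).aestronglyMeasurable ((A.card : ℝ) ^ 2)
      (ae_of_all _ fun z => ?_)
    rw [norm_pow, Real.norm_eq_abs]
    exact pow_le_pow_left₀ (abs_nonneg _) (hYb z) 2
  have hY2 : ∫ z, Y z ^ 2 ∂μ ≤ Fintype.card W * 5 ^ (2 * R + 2) := by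
    have h1 := integral_sum_sq_le (s := A) (f := fun v z => improvedSpin H σ c R I z v)
      (A := fun v => H.closedBallFinset v (R + 1)) measurable_improvedSpin
      (fun v z => (habs v z).le) (fun v z z' h => improvedSpin_congr h) ae_improvedSpin_neg
      (D := 5 ^ (2 * R + 2)) (T := fun v => H.closedBallFinset v (2 * R + 2))
      (fun v hv => (hA v hv).card_closedBallFinset_le hr) (fun u _ v _ huv => by
        rw [Finset.disjoint_left]
        intro x hx hx'
        refine huv ?_
        have := mem_closedBallFinset_trans hx (mem_closedBallFinset_comm.1 hx')
        rwa [show R + 1 + (R + 1) = 2 * R + 2 by ring] at this)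
    refine h1.trans ?_
    push_cast
    have := Finset.card_le_univ A
    gcongr
  have hFsum : ∀ z, F z =
      ∑ v ∈ I, {z | v ∈ frustrated H σ I (waveSpin H c R z)}.indicator (fun _ => (1 : ℝ)) z := by
    intro z
    rw [hF]
    beta_reduce
    conv_lhs => rw [frustrated, Finset.card_filter]
    push_cast
    refine Finset.sum_congr rfl fun v hv => ?_
    simp [Set.indicator_apply, frustrated, hv]
  have hFint : ∀ v, Integrable ({z | v ∈ frustrated H σ I (waveSpin H c R z)}.indicator
      fun _ => (1 : ℝ)) μ := fun v => (integrable_const 1).indicator (measurableSet_frustrated v)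
  have hFi : Integrable F μ := by
    rw [show F = _ from funext hFsum]
    exact integrable_finsetSum _ fun v _ => hFint v
  have hFle : p * (A.card / 5) ≤ ∫ z, F z ∂μ := by
    have h1 : ∀ v ∈ I, p ≤ ∫ z, {z | v ∈ frustrated H σ I (waveSpin H c R z)}.indicator
        (fun _ => (1 : ℝ)) z ∂μ := by
      intro v hv
      rw [integral_indicator_const _ (measurableSet_frustrated v), smul_eq_mul, mul_one]
      simpa [frustrated, hv] using hflip v (hIA hv)
    simp_rw [hFsum]
    rw [integral_finsetSum _ fun v _ => hFint v]
    refine le_trans ?_ (Finset.card_nsmul_le_sum _ _ _ h1)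
    have h2 : (A.card : ℝ) ≤ 5 * I.card := by exact_mod_cast hIcard
    rw [nsmul_eq_mul]
    nlinarith
  obtain ⟨z, hz⟩ := exists_le_integral (μ := μ) (((hE.sub (hFi.const_mul 2)).add
    ((hYi.div_const t).const_mul 4)))
  simp only [Pi.add_apply, Pi.sub_apply] at hz
  rw [integral_add (f := fun z => spinEnergy H σ (waveSpin H c R z) - 2 * F z)
    (hE.sub (hFi.const_mul 2)) ((hYi.div_const t).const_mul 4),
    integral_sub hE (hFi.const_mul 2), integral_const_mul, integral_const_mul,
    integral_div] at hz
  obtain ⟨s, hs1, hs2, hs3⟩ := exists_abs_sum_le_one_spinEnergy_le hσ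
    (improvedSpin_eq_or (H := H) (σ := σ) (c := c) (R := R) (I := I) z) hdeg hcard
  refine ⟨s, hs1, hs2, hs3.trans ?_⟩
  have h1 : spinEnergy H σ (improvedSpin H σ c R I z) ≤
      spinEnergy H σ (waveSpin H c R z) - 2 * F z := by
    refine spinEnergy_flipSpin_le_sub (Set.Pairwise.mono (fun v hv => ?_) hI) ?_
    · exact (Finset.mem_filter.1 hv).1
    · intro v hv
      exact (Finset.mem_filter.1 hv).2
  have h2 : |∑ v, improvedSpin H σ c R I z v| ≤ |Y z| + (Fintype.card W - A.card) := by
    rw [← Finset.sum_add_sum_compl A]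
    refine (abs_add_le _ _).trans ?_
    gcongr
    refine (Finset.abs_sum_le_sum_abs _ _).trans ?_
    have := Finset.card_le_univ A
    simp [habs, Finset.card_compl, Nat.cast_sub this]
  have h3 : |Y z| ≤ Y z ^ 2 / t + t := by
    rw [← sub_le_iff_le_add, le_div_iff₀ ht, ← sq_abs]
    nlinarith [sq_nonneg (|Y z| - t), abs_nonneg (Y z), mul_nonneg (abs_nonneg (Y z)) ht.le]
  have h4 : (∫ z, Y z ^ 2 ∂μ) / t ≤ Fintype.card W * 5 ^ (2 * R + 2) / t := by gcongr
  push_cast at hs3 ⊢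
  linarith

end SimpleGraph

namespace SimpleGraph

open MeasureTheory ProbabilityTheory

theorem _root_.TreeLikeVtx.le_card {W : Type} [Fintype W] {H : SimpleGraph W} {v : W} {r : ℕ}
    (hv : TreeLikeVtx H 4 (r + 1) v) : r ≤ Fintype.card W := by
  classical
  have h1 : 0 < H.degree v := by rw [hv.degree_eq (by omega)]; norm_num
  obtain ⟨w, hw⟩ := (H.degree_pos_iff_exists_adj v).1 h1
  calc r ≤ 3 ^ r := (Nat.lt_pow_self (by norm_num)).le
    _ = (H.branch v w r).card := (hv.card_branch hw r le_rfl).symm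
    _ ≤ Fintype.card W := Finset.card_le_univ _

theorem tendsto_card_of_treeLikeVtx {V : ℕ → Type} [∀ k, Fintype (V k)]
    {G : ∀ k, SimpleGraph (V k)}
    (htree : ∀ r : ℕ, Tendsto
      (fun k => ({x : V k | TreeLikeVtx (G k) 4 r x}.ncard : ℝ) / (Fintype.card (V k)))
      atTop (nhds 1)) :
    Tendsto (fun k => (Fintype.card (V k) : ℝ)) atTop atTop := by
  refine tendsto_natCast_atTop_atTop.comp (tendsto_atTop.2 fun r => ?_)
  filter_upwards [(htree (r + 1)).eventually_ne one_ne_zero] with k hk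
  have h1 : {x : V k | TreeLikeVtx (G k) 4 (r + 1) x}.Nonempty := by
    rw [Set.nonempty_iff_ne_empty]
    intro h
    simp [h] at hk
  obtain ⟨v, hv⟩ := h1
  exact TreeLikeVtx.le_card hv

open Classical in
theorem exists_eventually_spinEnergy_le {V : ℕ → Type} [∀ k, Fintype (V k)]
    {G : ∀ k, SimpleGraph (V k)} {σ : ℝ} (hσ : σ ^ 2 = 1)
    (htree : ∀ r : ℕ, Tendsto
      (fun k => ({x : V k | TreeLikeVtx (G k) 4 r x}.ncard : ℝ) / (Fintype.card (V k)))
      atTop (nhds 1))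
    (hdeg : Tendsto
      (fun k => 2 * (((G k).edgeSet.ncard : ℝ)) / (Fintype.card (V k)))
      atTop (nhds 4)) :
    ∃ δ > 0, ∀ᶠ k in atTop, ∃ s : V k → ℝ, (∀ v, s v = 1 ∨ s v = -1) ∧ |∑ v, s v| ≤ 1 ∧
      spinEnergy (G k) σ s / Fintype.card (V k) ≤ 1 / 3 - δ := by
  obtain ⟨p, hp, R₁, hflip⟩ := exists_le_stdGaussian_real_sum_spin_le hσ
  obtain ⟨R₂, hedge⟩ := exists_integral_spin_mul_spin_le (ε := p / 20) (by positivity) hσ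
  set R := max R₁ R₂
  set r := 2 * (R + 1) + 2 with hr
  refine ⟨p / 10, by positivity, ?_⟩
  have hn := tendsto_card_of_treeLikeVtx htree
  have hlim : Tendsto (fun k => (1 / 6 + p / 20 + 2) / 2 *
      (2 * (((G k).edgeSet.ncard : ℝ)) / (Fintype.card (V k))) -
      (8 + 2 / 5 * p) *
        (({x : V k | TreeLikeVtx (G k) 4 r x}.ncard : ℝ) / (Fintype.card (V k))) +
      4 * (5 ^ r / (p / 40) / (Fintype.card (V k) : ℝ) + p / 40 + 1)) atTop
      (nhds ((1 / 6 + p / 20 + 2) / 2 * 4 - (8 + 2 / 5 * p) * 1 + 4 * (0 + p / 40 + 1))) :=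
    ((hdeg.const_mul _).sub ((htree r).const_mul _)).add
      ((((tendsto_const_nhds.div_atTop hn).add_const _).add_const _).const_mul _)
  have hlt : (1 / 6 + p / 20 + 2) / 2 * 4 - (8 + 2 / 5 * p) * 1 + 4 * (0 + p / 40 + 1) <
      1 / 3 - p / 10 := by linarith
  filter_upwards [hlim.eventually_lt_const hlt, hn.eventually_gt_atTop 0,
    (htree r).eventually_const_le (show (1 / 2 : ℝ) < 1 by norm_num)] with k hk hpos hhalf
  set A : Finset (V k) := {x | TreeLikeVtx (G k) 4 r x} with hA
  have hAc : ({x : V k | TreeLikeVtx (G k) 4 r x}.ncard : ℝ) = A.card := by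
    rw [Set.ncard_eq_toFinset_card', hA]
    congr 2
    ext
    simp
  rw [hAc] at hk hhalf
  have hA' : ∀ v ∈ A, TreeLikeVtx (G k) 4 r v := fun v hv => (Finset.mem_filter.1 hv).2
  obtain ⟨s, hs1, hs2, hs3⟩ := exists_balanced_spinEnergy_le (H := G k) (c := σ / √3) (R := R + 1)
    (A := A) (p := p) (q := 1 / 6 + p / 20) (t := p / 40 * Fintype.card (V k)) (r := r) hσ
    (by positivity) hp.le (by positivity) le_rfl hA'
    (by
      rw [le_div_iff₀ hpos] at hhalf
      have : (Fintype.card (V k) : ℝ) ≤ 2 * A.card := by linarith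
      exact_mod_cast this)
    (fun v hv w hw hvw => hedge R (le_max_right _ _) (hA' v hv) (hA' w hw) (by omega) hvw)
    (fun v hv => hflip R (le_max_left _ _) (hA' v hv) (by omega) (by simp))
  refine ⟨s, hs1, hs2, le_trans ?_ hk.le⟩
  rw [div_le_iff₀ hpos]
  refine hs3.trans (le_of_eq ?_)
  field_simp
  ring

end SimpleGraph

/-- If the random weak limit of finite graphs `G k` is the 4-regular tree and the average
degree tends to 4, then the asymptotic minimum bisection is strictly less than `1/3` and
the asymptotic maximum bisection is strictly greater than `5/3`. -/
theorem bisection_bounds_of_quartic_treelike (V : ℕ → Type) [∀ k, Fintype (V k)]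
    (G : ∀ k, SimpleGraph (V k))
    (htree : ∀ r : ℕ, Tendsto
      (fun k => ({x : V k | TreeLikeVtx (G k) 4 r x}.ncard : ℝ) / (Fintype.card (V k)))
      atTop (nhds 1))
    (hdeg : Tendsto
      (fun k => 2 * (((G k).edgeSet.ncard : ℝ)) / (Fintype.card (V k)))
      atTop (nhds 4)) :
    limsup (fun k => sInf {q : ℝ | ∃ S : Set (V k), IsBisection S ∧
        q = (bisectionSize (G k) S : ℝ) / (Fintype.card (V k))}) atTop < 1 / 3 ∧
    liminf (fun k => sSup {q : ℝ | ∃ S : Set (V k), IsBisection S ∧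
        q = (bisectionSize (G k) S : ℝ) / (Fintype.card (V k))}) atTop > 5 / 3 := by
  classical
  have hE : Tendsto (fun k => ((G k).edgeSet.ncard : ℝ) / Fintype.card (V k)) atTop (nhds 2) := by
    convert hdeg.div_const 2 using 2 <;> ring
  constructor
  · obtain ⟨δ, hδ, h⟩ := SimpleGraph.exists_eventually_spinEnergy_le (σ := 1) (by norm_num) htree hdeg
    refine lt_of_le_of_lt (limsup_le_of_le ?_ (h.mono fun k hk => ?_))
      (show (1 / 3 - δ : ℝ) < 1 / 3 by linarith)
    · refine isCoboundedUnder_le_of_le atTop (x := 0) fun k => Real.sInf_nonneg ?_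
      rintro _ ⟨S, -, rfl⟩
      positivity
    · obtain ⟨s, hs, hsum, hle⟩ := hk
      rw [← SimpleGraph.bisectionSize_eq_spinEnergy hs] at hle
      refine le_trans (csInf_le ⟨0, ?_⟩ ⟨_, SimpleGraph.isBisection_of_abs_sum_le_one hs hsum, rfl⟩) hle
      rintro _ ⟨S, -, rfl⟩
      positivity
  · have hub : ∀ k, (((G k).edgeSet.ncard : ℝ) / Fintype.card (V k)) ∈
        upperBounds {q : ℝ | ∃ S : Set (V k), IsBisection S ∧
          q = (bisectionSize (G k) S : ℝ) / (Fintype.card (V k))} := by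
      rintro k _ ⟨S, -, rfl⟩
      have : bisectionSize (G k) S ≤ (G k).edgeSet.ncard :=
        Set.ncard_le_ncard (Set.sep_subset _ _) (Set.toFinite _)
      gcongr
    obtain ⟨δ, hδ, h⟩ := SimpleGraph.exists_eventually_spinEnergy_le (σ := -1) (by norm_num) htree hdeg
    refine lt_of_lt_of_le (show (5 / 3 : ℝ) < 5 / 3 + δ / 2 by linarith) (le_liminf_of_le ?_ ?_)
    · obtain ⟨B, hB⟩ := hE.bddAbove_range
      refine isCoboundedUnder_ge_of_le atTop (x := B) fun k => ?_
      exact Real.sSup_le (fun q hq => (hub k hq).trans (hB ⟨k, rfl⟩))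
        ((by positivity : (0 : ℝ) ≤ _ / _).trans (hB ⟨k, rfl⟩))
    · filter_upwards [h, hE.eventually_const_lt (show 2 - δ / 2 < (2 : ℝ) by linarith)] with k hk hk'
      obtain ⟨s, hs, hsum, hle⟩ := hk
      refine le_trans ?_ (le_csSup ⟨_, hub k⟩ ⟨_, SimpleGraph.isBisection_of_abs_sum_le_one hs hsum, rfl⟩)
      rw [SimpleGraph.bisectionSize_eq_spinEnergy hs,
        eq_sub_of_add_eq (SimpleGraph.spinEnergy_add_spinEnergy_neg (H := G k) (σ := 1) (s := s)), sub_div]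
      linarith
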